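/- arXiv:1105.5756 — 2 statements merged into one kernel-verified Lean document; each statement's English description precedes it below -/
import Mathlib

section
/- Let K be an algebraically closed field (of any characteristic) and n ≥ 3. The projective dimension of the coordinate ring O_{1,2,n} of the Kalman variety K_{1,2,n}, as a module over the polynomial ring A, equals 2n − 5. -/
set_option synthInstance.maxHeartbeats 1000000
set_option maxHeartbeats 4000000

open Matrix

/-- The span of the first `d` standard basis vectors of `K^n`. -/
def firstCoordsSubspace (K : Type*) [Field K] (n d : ℕ) : Submodule K (Fin n → K) where
  carrier := {v | ∀ i : Fin n, d ≤ (i : ℕ) → v i = 0}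
  add_mem' := fun hv hw i hi => by simp [hv i hi, hw i hi]
  zero_mem' := fun i _ => rfl
  smul_mem' := fun c v hv i hi => by simp [hv i hi]

/-- The Kalman variety `K_{s,d,n}`: matrices having an `s`-dimensional invariant
subspace contained in the span `L` of the first `d` standard basis vectors. -/
def kalmanSet (K : Type*) [Field K] (n d s : ℕ) : Set (Matrix (Fin n) (Fin n) K) :=
  {M | ∃ U : Submodule K (Fin n → K), U ≤ firstCoordsSubspace K n d ∧
    Module.finrank K U = s ∧ ∀ v ∈ U, M.mulVec v ∈ U}

/-- The upper-left `d × d` block `α` of an `n × n` matrix. -/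
def alphaBlock {K : Type*} [Field K] {n : ℕ} (d : ℕ) (h : d ≤ n)
    (M : Matrix (Fin n) (Fin n) K) : Matrix (Fin d) (Fin d) K :=
  fun i j => M (Fin.castLE h i) (Fin.castLE h j)

/-- The lower-left `(n-d) × d` block `γ` of an `n × n` matrix. -/
def gammaBlock {K : Type*} [Field K] {n : ℕ} (d : ℕ) (h : d ≤ n)
    (M : Matrix (Fin n) (Fin n) K) : Matrix (Fin (n - d)) (Fin d) K :=
  fun i j => M ⟨d + (i : ℕ), by have := i.isLt; omega⟩ (Fin.castLE h j)

/-- The reduced Kalman matrix: the `d(n-d) × d` matrix obtained by stacking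
`γ, γα, γα², …, γα^{d-1}`; row `(k, i)` is row `i` of the block `γ * α^k`. -/
def redKalman {K : Type*} [Field K] {n : ℕ} (d : ℕ) (h : d ≤ n)
    (M : Matrix (Fin n) (Fin n) K) : Matrix (Fin d × Fin (n - d)) (Fin d) K :=
  fun p j => (gammaBlock d h M * (alphaBlock d h M) ^ (p.1 : ℕ)) p.2 j

/-- The vanishing ideal of a set of `n × n` matrices, inside the polynomial
coordinate ring `A = K[x_{ij}]` of the matrix space. -/
def matVanishingIdeal (K : Type*) [Field K] (n : ℕ)
    (S : Set (Matrix (Fin n) (Fin n) K)) : Ideal (MvPolynomial (Fin n × Fin n) K) where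
  carrier := {f | ∀ M ∈ S, MvPolynomial.eval (fun p => M p.1 p.2) f = 0}
  add_mem' := fun ha hb M hM => by simp [ha M hM, hb M hM]
  zero_mem' := fun M hM => by simp
  smul_mem' := fun c f hf M hM => by simp [smul_eq_mul, hf M hM]

/-- The coordinate ring `A` of the space of `n × n` matrices. -/
abbrev MatCoordRing (K : Type*) [Field K] (n : ℕ) := MvPolynomial (Fin n × Fin n) K

/-- The vanishing ideal `I_{s,d,n}` of the Kalman variety. -/
noncomputable def kalmanIdeal (K : Type*) [Field K] (n d s : ℕ) :
    Ideal (MatCoordRing K n) :=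
  matVanishingIdeal K n (kalmanSet K n d s)

/-- The irrelevant (maximal graded) ideal `A₊` of the polynomial ring,
generated by all the variables. -/
noncomputable def irrelevantIdeal (K : Type*) [Field K] (n : ℕ) :
    Ideal (MatCoordRing K n) :=
  Ideal.span (Set.range MvPolynomial.X)

/-- The coordinate ring `O_{s,d,n} = A/I_{s,d,n}` of the Kalman variety. -/
abbrev KalmanCoordRing (K : Type*) [Field K] (n d s : ℕ) :=
  MatCoordRing K n ⧸ kalmanIdeal K n d s

/-- The normalization `Õ_{s,d,n}`: the integral closure of `O_{s,d,n}` in its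
total ring of fractions (which is its field of fractions when `O_{s,d,n}` is a
domain, e.g. when `K` is algebraically closed). -/
def KalmanNormalization (K : Type*) [Field K] (n d s : ℕ) : Type _ :=
  ↥(integralClosure (KalmanCoordRing K n d s) (FractionRing (KalmanCoordRing K n d s)))

noncomputable instance (K : Type*) [Field K] (n d s : ℕ) :
    CommRing (KalmanNormalization K n d s) :=
  Subalgebra.toCommRing (R := KalmanCoordRing K n d s)
    (A := FractionRing (KalmanCoordRing K n d s)) (integralClosure _ _)

noncomputable instance (K : Type*) [Field K] (n d s : ℕ) :
    Algebra (KalmanCoordRing K n d s) (KalmanNormalization K n d s) :=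
  Subalgebra.algebra (R := KalmanCoordRing K n d s)
    (A := FractionRing (KalmanCoordRing K n d s)) (integralClosure _ _)

noncomputable instance (K : Type*) [Field K] (n d s : ℕ) :
    Algebra (MatCoordRing K n) (KalmanNormalization K n d s) :=
  ((algebraMap (KalmanCoordRing K n d s) (KalmanNormalization K n d s)).comp
    (algebraMap (MatCoordRing K n) (KalmanCoordRing K n d s))).toAlgebra

instance (K : Type*) [Field K] (n d s : ℕ) :
    IsScalarTower (MatCoordRing K n) (KalmanCoordRing K n d s)
      (KalmanNormalization K n d s) :=
  IsScalarTower.of_algebraMap_eq' (R := MatCoordRing K n)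
    (S := KalmanCoordRing K n d s) (A := KalmanNormalization K n d s) rfl

noncomputable instance (K : Type*) [Field K] (n d s : ℕ) :
    Algebra K (KalmanNormalization K n d s) :=
  ((algebraMap (KalmanCoordRing K n d s) (KalmanNormalization K n d s)).comp
    (algebraMap K (KalmanCoordRing K n d s))).toAlgebra

instance (K : Type*) [Field K] (n d s : ℕ) :
    IsScalarTower K (MatCoordRing K n) (KalmanNormalization K n d s) :=
  IsScalarTower.of_algebraMap_eq fun x => by
    show algebraMap (KalmanCoordRing K n d s) _ (algebraMap K _ x) =
      algebraMap (KalmanCoordRing K n d s) _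
        (algebraMap (MatCoordRing K n) _ (algebraMap K (MatCoordRing K n) x))
    rw [← IsScalarTower.algebraMap_apply K (MatCoordRing K n) (KalmanCoordRing K n d s)]

/-- The inclusion of `O_{s,d,n}` into its normalization `Õ_{s,d,n}`,
as an `A`-module map. -/
noncomputable def kalmanNormInclusion (K : Type*) [Field K] (n d s : ℕ) :
    KalmanCoordRing K n d s →ₗ[MatCoordRing K n] KalmanNormalization K n d s :=
  (IsScalarTower.toAlgHom (MatCoordRing K n) (KalmanCoordRing K n d s)
    (KalmanNormalization K n d s)).toLinearMap

universe u v

/-- `projDimLE R k M` means that `M` admits a projective resolution of length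
at most `k`, i.e. the projective dimension of `M` is `≤ k`. -/
def projDimLE (R : Type u) [Ring R] :
    ℕ → (M : Type max u v) → [AddCommGroup M] → [Module R M] → Prop
  | 0, M, _, _ => Module.Projective R M
  | (k + 1), M, _, _ =>
      ∃ (P : Type max u v) (_ : AddCommGroup P) (_ : Module R P)
        (f : P →ₗ[R] M), Module.Projective R P ∧ Function.Surjective f ∧
          projDimLE R k (LinearMap.ker f)

/-- `projDimEq R M k` means that the projective dimension of the `R`-module `M`
equals `k` (in particular it is finite). -/
def projDimEq (R : Type u) [Ring R] (M : Type max u v) [AddCommGroup M]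
    [Module R M] (k : ℕ) : Prop :=
  projDimLE R k M ∧ ∀ l : ℕ, projDimLE R l M → k ≤ l

section Homological

open CategoryTheory Abelian

universe w

variable {R : Type u} [CommRing R]

/-- The projective dimension of `M` is `< k`. -/
abbrev PdLT (R : Type u) [CommRing R] [Small.{w} R] (M : Type w) [AddCommGroup M] [Module R M]
    (k : ℕ) : Prop :=
  HasProjectiveDimensionLT (ModuleCat.of R M) k

section

variable {M N L : Type w} [AddCommGroup M] [AddCommGroup N] [AddCommGroup L]
  [Module R M] [Module R N] [Module R L]

/-- The short complex attached to an exact pair of linear maps. -/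
noncomputable abbrev shortComplexOfExact {f : M →ₗ[R] N} {g : N →ₗ[R] L}
    (h : Function.Exact f g) : ShortComplex (ModuleCat.{w} R) :=
  ShortComplex.mk (ModuleCat.ofHom f) (ModuleCat.ofHom g) (by
    ext x; exact h.apply_apply_eq_zero x)

theorem shortExact_shortComplexOfExact {f : M →ₗ[R] N} {g : N →ₗ[R] L}
    (h : Function.Exact f g) (hf : Function.Injective f) (hg : Function.Surjective g) :
    (shortComplexOfExact h).ShortExact :=
  ModuleCat.shortComplex_shortExact _ h hf hg

variable [Small.{w} R]

theorem PdLT.mono {k l : ℕ} (h : PdLT R M k) (hkl : k ≤ l) : PdLT R M l :=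
  hasProjectiveDimensionLT_of_ge _ k l hkl

theorem PdLT.of_equiv {k : ℕ} (e : M ≃ₗ[R] N) (h : PdLT R M k) : PdLT R N k :=
  hasProjectiveDimensionLT_of_iso e.toModuleIso k

theorem PdLT.of_projective [Module.Projective R M] : PdLT R M 1 := by
  rw [PdLT, ← projective_iff_hasProjectiveDimensionLT_one, ← IsProjective.iff_projective]
  infer_instance

theorem PdLT.left {f : M →ₗ[R] N} {g : N →ₗ[R] L} (h : Function.Exact f g)
    (hf : Function.Injective f) (hg : Function.Surjective g) {k : ℕ}
    (hN : PdLT R N k) (hL : PdLT R L (k + 1)) : PdLT R M k :=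
  (shortExact_shortComplexOfExact h hf hg).hasProjectiveDimensionLT_X₁ k hN hL

theorem PdLT.right {f : M →ₗ[R] N} {g : N →ₗ[R] L} (h : Function.Exact f g)
    (hf : Function.Injective f) (hg : Function.Surjective g) {k : ℕ}
    (hM : PdLT R M k) (hN : PdLT R N (k + 1)) : PdLT R L (k + 1) :=
  (shortExact_shortComplexOfExact h hf hg).hasProjectiveDimensionLT_X₃ k hM hN

/-- If `x` kills `N` and `Ext^{k+1}(L, N) = 0` for `L = M / x M` with `x` regular on `M`,
then `Ext^k(M, N) = 0`. -/
theorem subsingleton_ext_of_smul_exact {T : Type w} [AddCommGroup T] [Module R T] {x : R}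
    {g : M →ₗ[R] L} (h : Function.Exact (x • (LinearMap.id : M →ₗ[R] M)) g)
    (hf : Function.Injective (x • (LinearMap.id : M →ₗ[R] M))) (hg : Function.Surjective g)
    (hx : ∀ t : T, x • t = 0) {k : ℕ}
    (hL : Subsingleton (Ext (ModuleCat.of R L) (ModuleCat.of R T) (k + 1))) :
    Subsingleton (Ext (ModuleCat.of R M) (ModuleCat.of R T) k) := by
  have hS := shortExact_shortComplexOfExact h hf hg
  refine subsingleton_of_forall_eq 0 fun e => ?_
  obtain ⟨y, hy⟩ := Ext.contravariant_sequence_exact₁ hS (ModuleCat.of R T) e (add_comm 1 k)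
    (Subsingleton.elim _ _)
  have h1 : (shortComplexOfExact h).f = x • 𝟙 (ModuleCat.of R M) := rfl
  have h2 : x • 𝟙 (ModuleCat.of R T) = 0 := by ext t; exact hx t
  rw [← hy, h1, Ext.mk₀_smul, Ext.smul_comp, Ext.mk₀_id_comp]
  have h3 : x • y = y.comp (Ext.mk₀ (x • 𝟙 (ModuleCat.of R T))) (add_zero k) := by
    rw [Ext.mk₀_smul, Ext.comp_smul, Ext.comp_mk₀_id]
  rw [h3, h2, Ext.mk₀_zero, Ext.comp_zero]

end

end Homological

theorem projDimLE_iff_pdLT {R : Type u} [CommRing R] (k : ℕ) (M : Type max u v)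
    [AddCommGroup M] [Module R M] : projDimLE.{u, v} R k M ↔ PdLT.{u, max u v} R M (k + 1) := by
  induction k generalizing M with
  | zero =>
    rw [projDimLE, PdLT, zero_add, ← CategoryTheory.projective_iff_hasProjectiveDimensionLT_one,
      ← IsProjective.iff_projective]
  | succ k ih =>
    rw [projDimLE]
    constructor
    · rintro ⟨P, _, _, f, hP, hf, h⟩
      exact PdLT.right (f := f.ker.subtype) (g := f) (f.exact_subtype_ker_map)
        Subtype.val_injective hf ((ih _).1 h) (PdLT.of_projective.mono (by omega))
    · intro h
      let f : (M →₀ R) →ₗ[R] M := Finsupp.linearCombination R id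
      have hf : Function.Surjective f := Finsupp.linearCombination_id_surjective R M
      refine ⟨M →₀ R, inferInstance, inferInstance, f, inferInstance, hf, (ih _).2 ?_⟩
      exact PdLT.left (f := f.ker.subtype) (g := f) (f.exact_subtype_ker_map)
        Subtype.val_injective hf (PdLT.of_projective.mono (by omega)) h

section Koszul

open CategoryTheory Abelian

theorem exact_smul_factor {R : Type*} [CommRing R] (I J : Ideal R) (x : R)
    (hJ : J = I ⊔ Ideal.span {x}) (hIJ : I ≤ J) :
    Function.Exact (x • (LinearMap.id : (R ⧸ I) →ₗ[R] (R ⧸ I)))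
      (Ideal.Quotient.factorₐ R hIJ).toLinearMap := by
  intro y
  obtain ⟨y, rfl⟩ := Ideal.Quotient.mk_surjective y
  constructor
  · intro h
    have h : y ∈ I ⊔ Ideal.span {x} := hJ ▸ Ideal.Quotient.eq_zero_iff_mem.1 h
    obtain ⟨a, ha, b, hb, rfl⟩ := Submodule.mem_sup.1 h
    obtain ⟨c, rfl⟩ := Ideal.mem_span_singleton'.1 hb
    refine ⟨Ideal.Quotient.mk I c, ?_⟩
    have : Ideal.Quotient.mk I a = 0 := Ideal.Quotient.eq_zero_iff_mem.2 ha
    simp [this, Algebra.smul_def, mul_comm c]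
  · rintro ⟨z, hz⟩
    obtain ⟨z, rfl⟩ := Ideal.Quotient.mk_surjective z
    rw [← hz]
    have : x * z ∈ J :=
      J.mul_mem_right _ (hJ ▸ Ideal.mem_sup_right (Ideal.mem_span_singleton_self x))
    exact Ideal.Quotient.eq_zero_iff_mem.2 this

theorem injective_smul_id {R : Type*} [CommRing R] (I : Ideal R) (x : R)
    (hx : ∀ f, x * f ∈ I → f ∈ I) :
    Function.Injective (x • (LinearMap.id : (R ⧸ I) →ₗ[R] (R ⧸ I))) := by
  rw [injective_iff_map_eq_zero]
  intro y hy
  obtain ⟨y, rfl⟩ := Ideal.Quotient.mk_surjective y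
  exact Ideal.Quotient.eq_zero_iff_mem.2 (hx _ (Ideal.Quotient.eq_zero_iff_mem.1 hy))

variable {σ : Type} {K : Type u} [Field K]

theorem mem_span_X_of_X_mul_mem (V : Set σ) {a : σ} (ha : a ∉ V) {f : MvPolynomial σ K}
    (h : MvPolynomial.X a * f ∈ Ideal.span (MvPolynomial.X '' V)) :
    f ∈ Ideal.span (MvPolynomial.X '' V : Set (MvPolynomial σ K)) := by
  rw [MvPolynomial.mem_ideal_span_X_image] at h ⊢
  intro m hm
  obtain ⟨i, hi, him⟩ := h (Finsupp.single a 1 + m) (by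
    rw [MvPolynomial.mem_support_iff, MvPolynomial.coeff_X_mul]
    exact MvPolynomial.mem_support_iff.1 hm)
  refine ⟨i, hi, ?_⟩
  have : a ≠ i := fun e => ha (e ▸ hi)
  simpa [this] using him

theorem span_X_insert [DecidableEq σ] (V : Finset σ) (a : σ) :
    Ideal.span (MvPolynomial.X '' (insert a V : Finset σ) : Set (MvPolynomial σ K)) =
      Ideal.span (MvPolynomial.X '' (V : Set σ)) ⊔ Ideal.span {MvPolynomial.X a} := by
  rw [Finset.coe_insert, Set.image_insert_eq, Ideal.span_insert, sup_comm]

/-- The quotient by `r` variables has projective dimension at most `r`. -/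
theorem pdLT_quotient_span_X (V : Finset σ) :
    PdLT (MvPolynomial σ K)
      (MvPolynomial σ K ⧸ Ideal.span (MvPolynomial.X '' (V : Set σ) : Set (MvPolynomial σ K)))
      (V.card + 1) := by
  classical
  induction V using Finset.induction_on with
  | empty =>
    have e : Ideal.span
        (MvPolynomial.X '' ((∅ : Finset σ) : Set σ) : Set (MvPolynomial σ K)) = ⊥ := by
      simp
    have := PdLT.of_projective (R := MvPolynomial σ K) (M := MvPolynomial σ K)
    refine PdLT.of_equiv (Submodule.quotEquivOfEqBot _ e).symm ?_
    simpa using this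
  | insert a V ha ih =>
    rw [Finset.card_insert_of_notMem ha]
    have hle := le_sup_left.trans_eq (span_X_insert (K := K) V a).symm
    exact PdLT.right (exact_smul_factor _ _ _ (span_X_insert V a) hle)
      (injective_smul_id _ _ fun f => mem_span_X_of_X_mul_mem _ (by simpa using ha))
      (Ideal.Quotient.factor_surjective hle) ih (ih.mono (by omega))

theorem not_subsingleton_ext_quotient_span_X (V : Finset σ) {T : Type u} [AddCommGroup T]
    [Module (MvPolynomial σ K) T] [Nontrivial T]
    (hT : ∀ i ∈ V, ∀ t : T, (MvPolynomial.X i : MvPolynomial σ K) • t = 0) :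
    ¬ Subsingleton (Ext (ModuleCat.of (MvPolynomial σ K)
      (MvPolynomial σ K ⧸ Ideal.span (MvPolynomial.X '' (V : Set σ) : Set (MvPolynomial σ K))))
      (ModuleCat.of (MvPolynomial σ K) T) V.card) := by
  classical
  induction V using Finset.induction_on with
  | empty =>
    intro h
    have e : Ideal.span
        (MvPolynomial.X '' ((∅ : Finset σ) : Set σ) : Set (MvPolynomial σ K)) = ⊥ := by
      simp
    obtain ⟨t, ht⟩ := exists_ne (0 : T)
    rw [Finset.card_empty] at h
    have h2 := Ext.homEquiv₀.subsingleton_congr.1 h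
    have h3 := h2.elim (ModuleCat.ofHom ((LinearMap.toSpanSingleton (MvPolynomial σ K) T t).comp
      (Submodule.quotEquivOfEqBot _ e).toLinearMap)) 0
    have h4 := congrArg (fun f => f.hom (Submodule.Quotient.mk 1)) h3
    have h5 : (1 : MvPolynomial σ K) • t = 0 := h4
    exact ht (by simpa using h5)
  | insert a V ha ih =>
    intro h
    rw [Finset.card_insert_of_notMem ha] at h
    refine ih (fun i hi => hT i (Finset.mem_insert_of_mem hi)) ?_
    have hle := le_sup_left.trans_eq (span_X_insert (K := K) V a).symm
    exact subsingleton_ext_of_smul_exact (exact_smul_factor _ _ _ (span_X_insert V a) hle)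
      (injective_smul_id _ _ fun f => mem_span_X_of_X_mul_mem _ (by simpa using ha))
      (Ideal.Quotient.factor_surjective hle) (hT a (Finset.mem_insert_self _ _)) h

/-- The quotient by `r` variables does not have projective dimension smaller than `r`. -/
theorem not_pdLT_quotient_span_X (V : Finset σ) :
    ¬ PdLT (MvPolynomial σ K)
      (MvPolynomial σ K ⧸ Ideal.span (MvPolynomial.X '' (V : Set σ) : Set (MvPolynomial σ K)))
      V.card := by
  intro h
  have hne : Ideal.span (MvPolynomial.X '' (V : Set σ) : Set (MvPolynomial σ K)) ≠ ⊤ := by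
    rw [Ideal.ne_top_iff_one, MvPolynomial.mem_ideal_span_X_image]
    simp
  have := Ideal.Quotient.nontrivial_iff.2 hne
  refine not_subsingleton_ext_quotient_span_X V (T := MvPolynomial σ K ⧸
    Ideal.span (MvPolynomial.X '' (V : Set σ) : Set (MvPolynomial σ K))) ?_
    (h.subsingleton _ _ _ le_rfl _)
  intro i hi t
  obtain ⟨t, rfl⟩ := Ideal.Quotient.mk_surjective t
  exact Ideal.Quotient.eq_zero_iff_mem.2
    (Ideal.mul_mem_right _ _ (Ideal.subset_span ⟨i, hi, rfl⟩))

end Koszul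


section Slope

open Polynomial in
theorem mem_span_X_pow_of_X_mul_mem {τ K : Type*} [Field K] (V : Set τ) {a : τ} (ha : a ∉ V)
    (i : ℕ) {f : MvPolynomial τ K}
    (h : MvPolynomial.X a * f ∈ Ideal.span (MvPolynomial.X '' V) ^ i) :
    f ∈ Ideal.span (MvPolynomial.X '' V : Set (MvPolynomial τ K)) ^ i := by
  classical
  set I := Ideal.span (MvPolynomial.X '' V : Set (MvPolynomial τ K)) with hI
  let δ : MvPolynomial τ K →ₐ[K] (MvPolynomial τ K)[X] :=
    MvPolynomial.aeval fun v => if v ∈ V then C (MvPolynomial.X v) * X else C (MvPolynomial.X v)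
  have hrees (g) : δ g ∈ reesAlgebra I := by
    induction g using MvPolynomial.induction_on with
    | C c =>
      rw [MvPolynomial.algHom_C]
      exact (reesAlgebra I).algebraMap_mem (MvPolynomial.C c)
    | add p q hp hq => rw [map_add]; exact add_mem hp hq
    | mul_X p v hp =>
      rw [map_mul]
      refine mul_mem hp ?_
      simp only [δ, MvPolynomial.aeval_X]
      split_ifs with hv
      · rw [C_mul_X_eq_monomial]
        refine reesAlgebra.monomial_mem.2 ?_
        rw [pow_one]
        exact Ideal.subset_span ⟨v, hv, rfl⟩
      · exact (reesAlgebra I).algebraMap_mem _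
  have heval (g) : (δ g).eval 1 = g := by
    have : (evalRingHom 1).comp (δ : MvPolynomial τ K →+* (MvPolynomial τ K)[X]) =
        RingHom.id _ := by
      refine MvPolynomial.ringHom_ext (fun c => ?_) fun v => ?_
      · simp [MvPolynomial.algebraMap_eq]
      · simp only [δ, RingHom.comp_apply, RingHom.coe_coe, MvPolynomial.aeval_X]
        split_ifs <;> simp
    exact DFunLike.congr_fun this g
  have hdvd (g) (hg : g ∈ I ^ i) : X ^ i ∣ δ g := by
    have hle : I ≤ (Ideal.span {X}).comap δ := by
      rw [hI, Ideal.span_le]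
      rintro _ ⟨v, hv, rfl⟩
      simp only [SetLike.mem_coe, Ideal.mem_comap, δ, MvPolynomial.aeval_X, if_pos hv]
      exact Ideal.mul_mem_left _ _ (Ideal.mem_span_singleton_self _)
    have := Ideal.le_comap_pow _ i (Ideal.pow_right_mono hle i hg)
    rwa [Ideal.mem_comap, Ideal.span_singleton_pow, Ideal.mem_span_singleton] at this
  have key := hdvd _ h
  rw [map_mul, X_pow_dvd_iff] at key
  simp only [δ, MvPolynomial.aeval_X, if_neg ha, coeff_C_mul] at key
  rw [← heval f, eval_eq_sum]
  refine Ideal.sum_mem _ fun l _ => ?_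
  simp only [one_pow, mul_one]
  rcases lt_or_ge l i with hl | hl
  · have h0 : (δ f).coeff l = 0 :=
      (mul_eq_zero.1 (key l hl)).resolve_left (MvPolynomial.X_ne_zero a)
    rw [h0]
    exact zero_mem _
  · exact Ideal.pow_le_pow_right hl (hrees f l)

theorem sub_mem_span_of_forall_X {τ K : Type*} [CommRing K]
    (φ : MvPolynomial τ K →ₐ[K] MvPolynomial τ K) (I : Ideal (MvPolynomial τ K))
    (h : ∀ v, MvPolynomial.X v - φ (MvPolynomial.X v) ∈ I) (f : MvPolynomial τ K) :
    f - φ f ∈ I := by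
  have : (Ideal.Quotient.mkₐ K I) = (Ideal.Quotient.mkₐ K I).comp φ :=
    MvPolynomial.algHom_ext fun v => (Ideal.Quotient.mk_eq_mk_iff_sub_mem _ _).2 (h v)
  exact (Ideal.Quotient.mk_eq_mk_iff_sub_mem _ _).1 (DFunLike.congr_fun this f)

open Polynomial

variable (K : Type*) [Field K] {ι ρ : Type}

/-- Polynomials in two families of variables `x`, `y` indexed by `ι` and some further variables. -/
abbrev PairRing (ι ρ : Type) := MvPolynomial (ι ⊕ ι ⊕ ρ) K

/-- The variables of the first family. -/
noncomputable abbrev xVar (j : ι) : PairRing K ι ρ := MvPolynomial.X (Sum.inl j)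

/-- The variables of the second family. -/
noncomputable abbrev yVar (j : ι) : PairRing K ι ρ := MvPolynomial.X (Sum.inr (Sum.inl j))

theorem generator_ne_zero {K : Type*} [Field K] (r : ι) :
    (C (xVar K r) - C (yVar K r) * X : (PairRing K ι ρ)[X]) ≠ 0 := by
  intro h
  have := congrArg (fun f => f.coeff 0) h
  simp at this

variable [DecidableEq ι]

/-- The substitution `x j ↦ y j * X` for `j ∈ S`, fixing all the other variables. -/
noncomputable def slopeHom (S : Finset ι) : PairRing K ι ρ →ₐ[K] (PairRing K ι ρ)[X] :=
  MvPolynomial.aeval (Sum.elim (fun j => if j ∈ S then C (yVar K j) * X else C (xVar K j))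
    fun k => C (MvPolynomial.X (Sum.inr k)))

/-- The substitution `x j ↦ 0` for `j ∈ S`, fixing all the other variables. -/
noncomputable def killHom (S : Finset ι) : PairRing K ι ρ →ₐ[K] PairRing K ι ρ :=
  MvPolynomial.aeval (Sum.elim (fun j => if j ∈ S then 0 else xVar K j)
    fun k => MvPolynomial.X (Sum.inr k))

/-- The ideal generated by the `y j` with `j ∈ S`. -/
noncomputable def yIdeal (ρ : Type) (S : Finset ι) : Ideal (PairRing K ι ρ) :=
  Ideal.span (MvPolynomial.X '' ((fun j => Sum.inr (Sum.inl j)) '' (S : Set ι)))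

variable {K}

section Substitution

variable {S : Finset ι}

@[simp] theorem slopeHom_x_of_mem {j : ι} (hj : j ∈ S) :
    slopeHom K S (xVar K j : PairRing K ι ρ) = C (yVar K j) * X := by
  simp [slopeHom, hj]

@[simp] theorem slopeHom_x_of_notMem {j : ι} (hj : j ∉ S) :
    slopeHom K S (xVar K j : PairRing K ι ρ) = C (xVar K j) := by
  simp [slopeHom, hj]

@[simp] theorem slopeHom_inr (k : ι ⊕ ρ) :
    slopeHom K S (MvPolynomial.X (Sum.inr k) : PairRing K ι ρ) =
      C (MvPolynomial.X (Sum.inr k)) := by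
  simp [slopeHom]

@[simp] theorem killHom_x_of_mem {j : ι} (hj : j ∈ S) :
    killHom (ρ := ρ) K S (xVar K j) = 0 := by
  simp [killHom, hj]

@[simp] theorem killHom_x_of_notMem {j : ι} (hj : j ∉ S) :
    killHom K S (xVar K j : PairRing K ι ρ) = xVar K j := by
  simp [killHom, hj]

@[simp] theorem killHom_inr (k : ι ⊕ ρ) :
    killHom K S (MvPolynomial.X (Sum.inr k) : PairRing K ι ρ) = MvPolynomial.X (Sum.inr k) := by
  simp [killHom]

end Substitution

theorem pairRing_algHom_ext {B : Type*} [Semiring B] [Algebra K B] {φ ψ : PairRing K ι ρ →ₐ[K] B}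
    (S : Finset ι) (h : ∀ j ∈ S, φ (xVar K j) = ψ (xVar K j))
    (h' : ∀ j ∉ S, φ (xVar K j) = ψ (xVar K j))
    (hr : ∀ k, φ (MvPolynomial.X (Sum.inr k)) = ψ (MvPolynomial.X (Sum.inr k))) : φ = ψ := by
  refine MvPolynomial.algHom_ext fun v => ?_
  rcases v with j | k
  · by_cases hj : j ∈ S
    · exact h j hj
    · exact h' j hj
  · exact hr k

theorem slopeHom_mem_reesAlgebra (S : Finset ι) (f : PairRing K ι ρ) :
    slopeHom K S f ∈ reesAlgebra (yIdeal K ρ S) := by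
  induction f using MvPolynomial.induction_on with
  | C c =>
    rw [MvPolynomial.algHom_C]
    exact (reesAlgebra _).algebraMap_mem (MvPolynomial.C c)
  | add p q hp hq => rw [map_add]; exact add_mem hp hq
  | mul_X p v hp =>
    rw [map_mul]
    refine mul_mem hp ?_
    rcases v with j | k
    · by_cases hj : j ∈ S
      · rw [slopeHom_x_of_mem hj, C_mul_X_eq_monomial]
        refine reesAlgebra.monomial_mem.2 ?_
        rw [pow_one]
        exact Ideal.subset_span ⟨_, ⟨j, hj, rfl⟩, rfl⟩
      · rw [slopeHom_x_of_notMem hj]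
        exact (reesAlgebra _).algebraMap_mem _
    · rw [slopeHom_inr]
      exact (reesAlgebra _).algebraMap_mem _

theorem map_killHom_slopeHom (S : Finset ι) (f : PairRing K ι ρ) :
    mapAlgHom (killHom K S) (slopeHom K S f) = slopeHom K S f := by
  have : (mapAlgHom (killHom K S)).comp (slopeHom K S) = slopeHom (ρ := ρ) K S :=
    pairRing_algHom_ext S (fun j hj => by simp [hj]) (fun j hj => by simp [hj])
      (fun k => by simp)
  exact DFunLike.congr_fun this f

theorem slopeHom_killHom (S : Finset ι) (f : PairRing K ι ρ) :
    slopeHom K S (killHom K S f) = C (killHom K S f) := by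
  have : (slopeHom K S).comp (killHom K S) = (CAlgHom (A := PairRing K ι ρ)).comp (killHom K S) :=
    pairRing_algHom_ext S (fun j hj => by simp [hj]) (fun j hj => by simp [hj])
      (fun k => by simp)
  exact DFunLike.congr_fun this f

theorem coeff_zero_slopeHom (S : Finset ι) (f : PairRing K ι ρ) :
    (slopeHom K S f).coeff 0 = killHom K S f := by
  have : ((aeval (R := PairRing K ι ρ) 0).restrictScalars K).comp (slopeHom K S) =
      killHom (ρ := ρ) K S :=
    pairRing_algHom_ext S (fun j hj => by simp [hj]) (fun j hj => by simp [hj])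
      (fun k => by simp)
  rw [coeff_zero_eq_aeval_zero]
  exact DFunLike.congr_fun this f

theorem exists_slopeHom_eq (S : Finset ι) {g : (PairRing K ι ρ)[X]}
    (hg : g ∈ reesAlgebra (yIdeal K ρ S)) :
    ∃ f, slopeHom K S f = mapAlgHom (killHom K S) g := by
  rw [← adjoin_monomial_eq_reesAlgebra] at hg
  have hC (a : PairRing K ι ρ) : ∃ f, slopeHom K S f =
      mapAlgHom (killHom K S) (C a) :=
    ⟨killHom K S a, by simp [slopeHom_killHom]⟩
  induction hg using Algebra.adjoin_induction with
  | mem g hg =>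
    obtain ⟨a, ha, rfl⟩ := hg
    change a ∈ yIdeal K ρ S at ha
    induction ha using Submodule.span_induction with
    | mem a ha =>
      obtain ⟨_, ⟨j, hj, rfl⟩, rfl⟩ := ha
      refine ⟨xVar K j, ?_⟩
      rw [slopeHom_x_of_mem hj, ← C_mul_X_eq_monomial]
      simp
    | zero => exact ⟨0, by simp⟩
    | add a b _ _ ha hb =>
      obtain ⟨f, hf⟩ := ha
      obtain ⟨g, hg⟩ := hb
      exact ⟨f + g, by rw [map_add, hf, hg, map_add, map_add]⟩
    | smul a b _ hb =>
      obtain ⟨f, hf⟩ := hC a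
      obtain ⟨g, hg⟩ := hb
      exact ⟨f * g, by rw [map_mul, hf, hg, ← map_mul, C_mul_monomial, smul_eq_mul]⟩
  | algebraMap a => exact hC a
  | add f g _ _ hf hg =>
    obtain ⟨f, hf⟩ := hf
    obtain ⟨g, hg⟩ := hg
    exact ⟨f + g, by rw [map_add, hf, hg, map_add]⟩
  | mul f g _ _ hf hg =>
    obtain ⟨f, hf⟩ := hf
    obtain ⟨g, hg⟩ := hg
    exact ⟨f * g, by rw [map_mul, hf, hg, map_mul]⟩

/-- The prime ideal of relations between the `x j` and the `y j` when `x j = y j * t` for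
`j ∈ S`. -/
noncomputable def slopeIdeal (K : Type*) [Field K] (ρ : Type) (S : Finset ι) :
    Ideal (PairRing K ι ρ) :=
  RingHom.ker (slopeHom (ρ := ρ) K S)

/-- The ideal generated by the `x j` with `j ∈ S`. -/
noncomputable def xIdeal (K : Type*) [Field K] (ρ : Type) (S : Finset ι) :
    Ideal (PairRing K ι ρ) :=
  RingHom.ker (killHom (ρ := ρ) K S)

theorem mem_slopeIdeal {S : Finset ι} {f : PairRing K ι ρ} :
    f ∈ slopeIdeal K ρ S ↔ slopeHom K S f = 0 := Iff.rfl

theorem mem_xIdeal {S : Finset ι} {f : PairRing K ι ρ} :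
    f ∈ xIdeal K ρ S ↔ killHom K S f = 0 := Iff.rfl

instance (S : Finset ι) : (slopeIdeal K ρ S).IsPrime :=
  RingHom.ker_isPrime (slopeHom (ρ := ρ) K S)

theorem xIdeal_eq_span (S : Finset ι) :
    xIdeal K ρ S = Ideal.span (MvPolynomial.X '' (Sum.inl '' (S : Set ι))) := by
  refine le_antisymm (fun f hf => ?_) (Ideal.span_le.2 ?_)
  · have := sub_mem_span_of_forall_X (killHom (ρ := ρ) K S)
      (Ideal.span (MvPolynomial.X '' (Sum.inl '' (S : Set ι)))) ?_ f
    · rwa [mem_xIdeal.1 hf, sub_zero] at this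
    · rintro (j | k)
      · by_cases hj : j ∈ S
        · rw [killHom_x_of_mem hj, sub_zero]
          exact Ideal.subset_span ⟨_, ⟨j, hj, rfl⟩, rfl⟩
        · rw [killHom_x_of_notMem hj, sub_self]
          exact zero_mem _
      · rw [killHom_inr, sub_self]
        exact zero_mem _
  · rintro _ ⟨_, ⟨j, hj, rfl⟩, rfl⟩
    exact killHom_x_of_mem hj

theorem slopeIdeal_le_xIdeal (S : Finset ι) : slopeIdeal K ρ S ≤ xIdeal K ρ S := fun f hf => by
  rw [mem_xIdeal, ← coeff_zero_slopeHom, mem_slopeIdeal.1 hf, coeff_zero]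

/-- The substitution `x r ↦ y r * X` on polynomials in `X`. -/
noncomputable def extendSlope (K : Type*) [Field K] (ρ : Type) (r : ι) :
    (PairRing K ι ρ)[X] →+* (PairRing K ι ρ)[X] :=
  eval₂RingHom ((slopeHom K {r} : PairRing K ι ρ →ₐ[K] (PairRing K ι ρ)[X]) : _ →+* _) X

@[simp] theorem extendSlope_C (r : ι) (a : PairRing K ι ρ) :
    extendSlope K ρ r (C a) = slopeHom K {r} a := by simp [extendSlope]

@[simp] theorem extendSlope_X (r : ι) : extendSlope K ρ r X = X := by simp [extendSlope]

theorem extendSlope_slopeHom {S : Finset ι} {r : ι} (hr : r ∉ S) (f : PairRing K ι ρ) :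
    extendSlope K ρ r (slopeHom K S f) = slopeHom K (insert r S) f := by
  have : (extendSlope K ρ r).comp (slopeHom (ρ := ρ) K S : PairRing K ι ρ →+* _) =
      (slopeHom K (insert r S) : PairRing K ι ρ →ₐ[K] (PairRing K ι ρ)[X]) := by
    refine MvPolynomial.ringHom_ext (fun c => ?_) fun v => ?_
    · simp only [RingHom.comp_apply, RingHom.coe_coe, MvPolynomial.algHom_C]
      rw [IsScalarTower.algebraMap_apply K (PairRing K ι ρ) _ c, algebraMap_eq, extendSlope_C,
        MvPolynomial.algebraMap_eq, MvPolynomial.algHom_C]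
      rfl
    · simp only [RingHom.comp_apply, RingHom.coe_coe]
      rcases v with j | k
      · by_cases hj : j ∈ S
        · rw [slopeHom_x_of_mem hj, slopeHom_x_of_mem (Finset.mem_insert_of_mem hj)]
          simp
        · rw [slopeHom_x_of_notMem hj, extendSlope_C]
          by_cases hjr : j = r
          · subst hjr
            rw [slopeHom_x_of_mem (Finset.mem_insert_self _ _), slopeHom_x_of_mem (by simp)]
          · rw [slopeHom_x_of_notMem (by simp [hjr]), slopeHom_x_of_notMem (by simp [hjr, hj])]
      · simp
  exact DFunLike.congr_fun this f

theorem slopeIdeal_le_insert {S : Finset ι} {r : ι} (hr : r ∉ S) :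
    slopeIdeal K ρ S ≤ slopeIdeal K ρ (insert r S) := fun f hf => by
  rw [mem_slopeIdeal, ← extendSlope_slopeHom hr, mem_slopeIdeal.1 hf, map_zero]

theorem extendSlope_generator (r : ι) :
    extendSlope K ρ r (C (xVar K r) - C (yVar K r) * X) = 0 := by
  rw [map_sub, map_mul, extendSlope_C, extendSlope_C, extendSlope_X, slopeHom_x_of_mem (by simp),
    slopeHom_inr, sub_self]

theorem dvd_of_extendSlope_eq_zero {r : ι} {f : (PairRing K ι ρ)[X]}
    (hf : extendSlope K ρ r f = 0) : C (xVar K r) - C (yVar K r) * X ∣ f := by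
  set I := Ideal.span {(C (xVar K r) - C (yVar K r) * X : (PairRing K ι ρ)[X])} with hI
  have : Ideal.Quotient.mk I = (Ideal.Quotient.mk I).comp (extendSlope K ρ r) := by
    refine Polynomial.ringHom_ext (fun a => ?_) (by simp)
    have h : ((Ideal.Quotient.mkₐ K I).comp (CAlgHom (A := PairRing K ι ρ))) =
        (Ideal.Quotient.mkₐ K I).comp (slopeHom K {r}) := by
      refine pairRing_algHom_ext {r} (fun j hj => ?_) (fun j hj => ?_) fun k => ?_
      · obtain rfl := Finset.mem_singleton.1 hj
        rw [AlgHom.comp_apply, AlgHom.comp_apply, slopeHom_x_of_mem hj]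
        exact (Ideal.Quotient.mk_eq_mk_iff_sub_mem _ _).2 (Ideal.mem_span_singleton_self _)
      · rw [AlgHom.comp_apply, AlgHom.comp_apply, slopeHom_x_of_notMem hj]
        rfl
      · rw [AlgHom.comp_apply, AlgHom.comp_apply, slopeHom_inr]
        rfl
    rw [RingHom.comp_apply, extendSlope_C]
    exact DFunLike.congr_fun h a
  have h2 := DFunLike.congr_fun this f
  rw [RingHom.comp_apply, hf, map_zero] at h2
  exact Ideal.mem_span_singleton.1 (Ideal.Quotient.eq_zero_iff_mem.1 h2)

theorem mapAlgHom_killHom_generator {S : Finset ι} {r : ι} (hr : r ∉ S) :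
    mapAlgHom (killHom K S) (C (xVar K r) - C (yVar K r) * X : (PairRing K ι ρ)[X]) =
      C (xVar K r) - C (yVar K r) * X := by
  simp [hr]

/-- The minor `x r * y s - y r * x s`. -/
noncomputable def minor (K : Type*) [Field K] (ρ : Type) (s r : ι) : PairRing K ι ρ :=
  xVar K r * yVar K s - yVar K r * xVar K s

section Step

variable {S : Finset ι} {s r : ι}

theorem slopeHom_minor (hs : s ∈ S) (hr : r ∉ S) :
    slopeHom K S (minor K ρ s r) =
    C (yVar K s) * (C (xVar K r) - C (yVar K r) * X) := by
  rw [minor, map_sub, map_mul, map_mul, slopeHom_x_of_mem hs, slopeHom_x_of_notMem hr,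
    slopeHom_inr, slopeHom_inr]
  ring

theorem minor_notMem_slopeIdeal (hs : s ∈ S) (hr : r ∉ S) :
    minor K ρ s r ∉ slopeIdeal K ρ S := by
  rw [mem_slopeIdeal, slopeHom_minor hs hr, mul_eq_zero, C_eq_zero]
  exact not_or.2 ⟨MvPolynomial.X_ne_zero _, generator_ne_zero r⟩

theorem xVar_notMem_slopeIdeal (hs : s ∈ S) : xVar K s ∉ slopeIdeal K ρ S := by
  rw [mem_slopeIdeal, slopeHom_x_of_mem hs, mul_eq_zero, C_eq_zero]
  exact not_or.2 ⟨MvPolynomial.X_ne_zero _, X_ne_zero⟩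

theorem minor_mem_slopeIdeal_insert (hs : s ∈ S) (hr : r ∉ S) :
    minor K ρ s r ∈ slopeIdeal K ρ (insert r S) := by
  rw [mem_slopeIdeal, ← extendSlope_slopeHom hr, slopeHom_minor hs hr, map_mul,
    extendSlope_generator, mul_zero]

theorem exists_mem_slopeIdeal_insert (hs : s ∈ S) (hr : r ∉ S)
    {q : PairRing K ι ρ} (hq : q ∈ xIdeal K ρ S) :
    ∃ i ∈ slopeIdeal K ρ (insert r S),
      minor K ρ s r * q - xVar K s * i ∈ slopeIdeal K ρ S := by
  obtain ⟨h, hh⟩ : X ∣ slopeHom K S q := by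
    rw [X_dvd_iff, coeff_zero_slopeHom]
    exact hq
  have hcoeff (k) : h.coeff k ∈ yIdeal K ρ S ^ (k + 1) := by
    have := slopeHom_mem_reesAlgebra S q (k + 1)
    rwa [hh, coeff_X_mul] at this
  have hfix : mapAlgHom (killHom K S) h = h := by
    have := map_killHom_slopeHom S q
    rw [hh, map_mul] at this
    simpa using this
  have hrees : (C (xVar K r) - C (yVar K r) * X) * h ∈ reesAlgebra (yIdeal K ρ S) := by
    intro k
    rw [sub_mul, coeff_sub, coeff_C_mul, mul_assoc, coeff_C_mul]
    refine sub_mem (Ideal.mul_mem_left _ _ (Ideal.pow_le_pow_right (by omega) (hcoeff k)))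
      (Ideal.mul_mem_left _ _ ?_)
    cases k with
    | zero => simp
    | succ k => rw [coeff_X_mul]; exact hcoeff k
  obtain ⟨i, hi⟩ := exists_slopeHom_eq S hrees
  rw [map_mul, mapAlgHom_killHom_generator hr, hfix] at hi
  refine ⟨i, ?_, ?_⟩
  · rw [mem_slopeIdeal, ← extendSlope_slopeHom hr, hi, map_mul, extendSlope_generator, zero_mul]
  · rw [mem_slopeIdeal, map_sub, map_mul, map_mul, slopeHom_minor hs hr, slopeHom_x_of_mem hs,
      hi, hh]
    ring

theorem exists_mem_xIdeal (hs : s ∈ S) (hr : r ∉ S)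
    {i : PairRing K ι ρ} (hi : i ∈ slopeIdeal K ρ (insert r S)) :
    ∃ q ∈ xIdeal K ρ S, minor K ρ s r * q - xVar K s * i ∈ slopeIdeal K ρ S := by
  obtain ⟨h, hh⟩ : C (xVar K r) - C (yVar K r) * X ∣ slopeHom K S i :=
    dvd_of_extendSlope_eq_zero (by rw [extendSlope_slopeHom hr]; exact hi)
  have hcoeff (k) : h.coeff k ∈ yIdeal K ρ S ^ (k + 1) := by
    have key (d k) (hk : h.natDegree < k + d) : h.coeff k ∈ yIdeal K ρ S ^ (k + 1) := by
      induction d generalizing k with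
      | zero => rw [coeff_eq_zero_of_natDegree_lt (by simpa using hk)]; exact zero_mem _
      | succ d ih =>
        have h1 := ih (k + 1) (by omega)
        have h2 := slopeHom_mem_reesAlgebra S i (k + 1)
        rw [hh, sub_mul, coeff_sub, coeff_C_mul, mul_assoc, coeff_C_mul, coeff_X_mul] at h2
        refine mem_span_X_pow_of_X_mul_mem (a := Sum.inr (Sum.inl r)) _ ?_ _ ?_
        · rintro ⟨j, hj, hjr⟩
          exact hr (Sum.inl_injective (Sum.inr_injective hjr) ▸ hj)
        · have h3 := sub_mem (Ideal.mul_mem_left _ (xVar K r)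
            (Ideal.pow_le_pow_right (by omega : k + 1 ≤ k + 1 + 1) h1)) h2
          rwa [sub_sub_cancel] at h3
    exact key (h.natDegree + 1) k (by omega)
  have hfix : mapAlgHom (killHom K S) h = h := by
    have := map_killHom_slopeHom S i
    rw [hh, map_mul, mapAlgHom_killHom_generator hr] at this
    exact mul_left_cancel₀ (generator_ne_zero r) this
  have hrees : X * h ∈ reesAlgebra (yIdeal K ρ S) := by
    rintro (_ | k)
    · simp
    · rw [coeff_X_mul]
      exact hcoeff k
  obtain ⟨q, hq⟩ := exists_slopeHom_eq S hrees
  rw [map_mul, hfix, coe_mapAlgHom, map_X] at hq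
  refine ⟨q, ?_, ?_⟩
  · rw [mem_xIdeal, ← coeff_zero_slopeHom, hq, coeff_X_mul_zero]
  · rw [mem_slopeIdeal, map_sub, map_mul, map_mul, slopeHom_minor hs hr, slopeHom_x_of_mem hs,
      hq, hh]
    ring

end Step

theorem slopeIdeal_singleton (s : ι) : slopeIdeal K ρ {s} = ⊥ := by
  rw [eq_bot_iff]
  intro f hf
  let F := FractionRing (PairRing K ι ρ)
  let φ := algebraMap (PairRing K ι ρ) F
  have hy : φ (yVar K s) ≠ 0 := by
    rw [Ne, FaithfulSMul.algebraMap_eq_zero_iff]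
    exact MvPolynomial.X_ne_zero _
  have : (eval₂RingHom φ (φ (xVar K s) / φ (yVar K s))).comp
      ((slopeHom K {s} : PairRing K ι ρ →ₐ[K] (PairRing K ι ρ)[X]) : _ →+* _) = φ := by
    refine MvPolynomial.ringHom_ext (fun c => ?_) fun v => ?_
    · simp only [RingHom.comp_apply, RingHom.coe_coe, MvPolynomial.algHom_C]
      rw [IsScalarTower.algebraMap_apply K (PairRing K ι ρ) _ c, algebraMap_eq,
        coe_eval₂RingHom, eval₂_C]
      rfl
    · simp only [RingHom.comp_apply, RingHom.coe_coe]
      rcases v with j | k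
      · by_cases hj : j = s
        · subst hj
          rw [slopeHom_x_of_mem (by simp)]
          simp [mul_div_cancel₀ _ hy]
        · rw [slopeHom_x_of_notMem (by simp [hj])]
          simp
      · simp
  have h := DFunLike.congr_fun this f
  rw [RingHom.comp_apply, RingHom.coe_coe, mem_slopeIdeal.1 hf, map_zero] at h
  exact (FaithfulSMul.algebraMap_eq_zero_iff (PairRing K ι ρ) F).1 h.symm

theorem slopeIdeal_pair {s r : ι} (hrs : r ≠ s) :
    slopeIdeal K ρ {r, s} = Ideal.span {minor K ρ s r} := by
  have hr : r ∉ ({s} : Finset ι) := by simpa using hrs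
  have hs := Finset.mem_singleton_self s
  refine le_antisymm (fun i hi => ?_) ?_
  · obtain ⟨q, hq, h⟩ := exists_mem_xIdeal hs hr hi
    rw [slopeIdeal_singleton, Ideal.mem_bot, sub_eq_zero] at h
    rw [xIdeal_eq_span, Finset.coe_singleton, Set.image_singleton, Set.image_singleton] at hq
    obtain ⟨c, rfl⟩ := Ideal.mem_span_singleton.1 hq
    refine Ideal.mem_span_singleton.2 ⟨c, mul_left_cancel₀ (MvPolynomial.X_ne_zero (Sum.inl s)) ?_⟩
    rw [← h]
    ring
  · rw [Ideal.span_singleton_le_iff_mem]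
    exact minor_mem_slopeIdeal_insert hs hr

end Slope

section Step

variable {R P : Type u} [CommRing R] [CommRing P] [Algebra R P]

/-- If `z Q = x I` in the domain `P / J`, then `I / J` and `Q / J` are isomorphic, so a bound on
the projective dimensions of `P / J` and `P / Q` gives one for `P / I`. -/
theorem pdLT_quotient_of_mul_eq {J I Q : Ideal P} [J.IsPrime] (hJI : J ≤ I) (hJQ : J ≤ Q) {x z : P}
    (hx : x ∉ J) (hz : z ∉ J) (hQI : ∀ q ∈ Q, ∃ i ∈ I, z * q - x * i ∈ J)
    (hIQ : ∀ i ∈ I, ∃ q ∈ Q, z * q - x * i ∈ J) {k : ℕ} (hPJ : PdLT R (P ⧸ J) k)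
    (hPQ : PdLT R (P ⧸ Q) (k + 1)) : PdLT R (P ⧸ I) (k + 1) := by
  let f := (Ideal.Quotient.factorₐ R hJQ).toLinearMap
  let g := (Ideal.Quotient.factorₐ R hJI).toLinearMap
  have hf : Function.Surjective f := Ideal.Quotient.factor_surjective hJQ
  have hg : Function.Surjective g := Ideal.Quotient.factor_surjective hJI
  have hmul {a : P} (ha : a ∉ J) :
      Function.Injective (LinearMap.mulLeft R (Ideal.Quotient.mk J a)) :=
    mul_right_injective₀ fun h => ha (Ideal.Quotient.eq_zero_iff_mem.1 h)
  have hmap : f.ker.map (LinearMap.mulLeft R (Ideal.Quotient.mk J z)) =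
      g.ker.map (LinearMap.mulLeft R (Ideal.Quotient.mk J x)) := by
    apply le_antisymm
    · rintro _ ⟨q, hq, rfl⟩
      obtain ⟨q, rfl⟩ := Ideal.Quotient.mk_surjective q
      obtain ⟨i, hi, h⟩ := hQI q (Ideal.Quotient.eq_zero_iff_mem.1 hq)
      refine ⟨Ideal.Quotient.mk J i, Ideal.Quotient.eq_zero_iff_mem.2 hi, ?_⟩
      simpa using ((Ideal.Quotient.mk_eq_mk_iff_sub_mem _ _).2 h).symm
    · rintro _ ⟨i, hi, rfl⟩
      obtain ⟨i, rfl⟩ := Ideal.Quotient.mk_surjective i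
      obtain ⟨q, hq, h⟩ := hIQ i (Ideal.Quotient.eq_zero_iff_mem.1 hi)
      refine ⟨Ideal.Quotient.mk J q, Ideal.Quotient.eq_zero_iff_mem.2 hq, ?_⟩
      simpa using (Ideal.Quotient.mk_eq_mk_iff_sub_mem _ _).2 h
  let e : f.ker ≃ₗ[R] g.ker :=
    (Submodule.equivMapOfInjective _ (hmul hz) f.ker).trans
      ((LinearEquiv.ofEq _ _ hmap).trans (Submodule.equivMapOfInjective _ (hmul hx) g.ker).symm)
  have h1 : PdLT R f.ker k := PdLT.left f.exact_subtype_ker_map Subtype.val_injective hf hPJ hPQ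
  exact PdLT.right g.exact_subtype_ker_map Subtype.val_injective hg (h1.of_equiv e)
    (hPJ.mono (by omega))

end Step

section Transport

open Polynomial

variable (K : Type u) [Field K] (m : ℕ)

/-- The pair ring whose variables are the entries of the first two columns of `M - λ` together
with `λ` and the entries of the remaining columns of `M`. -/
abbrev ShiftRing := PairRing K (Fin (m + 3)) (Option (Fin (m + 3) × Fin (m + 1)))

variable {m} in
/-- The entries of `M` expressed through the variables of `ShiftRing`. -/
noncomputable def shiftEntry (p : Fin (m + 3) × Fin (m + 3)) : ShiftRing K m :=
  Fin.cases (xVar K p.1 + if p.1 = 0 then MvPolynomial.X (Sum.inr (Sum.inr none)) else 0)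
    (fun j => Fin.cases
      (yVar K p.1 + if p.1 = 1 then MvPolynomial.X (Sum.inr (Sum.inr none)) else 0)
      (fun k => MvPolynomial.X (Sum.inr (Sum.inr (some (p.1, k))))) j) p.2

@[simp] theorem shiftEntry_zero (i : Fin (m + 3)) : shiftEntry K (i, 0) =
    xVar K i + if i = 0 then MvPolynomial.X (Sum.inr (Sum.inr none)) else 0 := rfl

@[simp] theorem shiftEntry_one (i : Fin (m + 3)) : shiftEntry K (i, 1) =
    yVar K i + if i = 1 then MvPolynomial.X (Sum.inr (Sum.inr none)) else 0 := rfl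

@[simp] theorem shiftEntry_succ_succ (i : Fin (m + 3)) (k : Fin (m + 1)) :
    shiftEntry K (i, k.succ.succ) = MvPolynomial.X (Sum.inr (Sum.inr (some (i, k)))) := rfl

/-- The variables of `ShiftRing` expressed through `λ` and the entries of `M`. -/
noncomputable def unshiftHom : ShiftRing K m →ₐ[K] (MatCoordRing K (m + 3))[X] :=
  MvPolynomial.aeval (Sum.elim (fun i => C (MvPolynomial.X (i, 0)) - if i = 0 then X else 0)
    (Sum.elim (fun i => C (MvPolynomial.X (i, 1)) - if i = 1 then X else 0)
      fun o => o.elim X fun p => C (MvPolynomial.X (p.1, p.2.succ.succ))))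

/-- The isomorphism `A[λ] ≃ ShiftRing`. -/
noncomputable def shiftEquiv : (MatCoordRing K (m + 3))[X] ≃+* ShiftRing K m :=
  RingEquiv.ofRingHom
    (eval₂RingHom (MvPolynomial.aeval (shiftEntry K) : MatCoordRing K (m + 3) →ₐ[K] ShiftRing K m)
      (MvPolynomial.X (Sum.inr (Sum.inr none))))
    (unshiftHom K m)
    (by
      refine MvPolynomial.ringHom_ext (fun c => ?_) fun v => ?_
      · simp only [RingHom.comp_apply, RingHom.coe_coe, MvPolynomial.algHom_C, RingHom.id_apply]
        rw [IsScalarTower.algebraMap_apply K (MatCoordRing K (m + 3)) _ c, algebraMap_eq,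
          coe_eval₂RingHom, eval₂_C, RingHom.coe_coe, AlgHom.commutes]
        rfl
      · rcases v with i | i | _ | p
        · by_cases hi : i = 0 <;> simp [unshiftHom, hi]
        · by_cases hi : i = 1 <;> simp [unshiftHom, hi]
        · simp [unshiftHom]
        · simp [unshiftHom])
    (by
      refine Polynomial.ringHom_ext (fun a => ?_) (by simp [unshiftHom])
      have : (unshiftHom K m).comp (MvPolynomial.aeval (shiftEntry K)) =
          CAlgHom (A := MatCoordRing K (m + 3)) := by
        refine MvPolynomial.algHom_ext fun p => ?_
        obtain ⟨i, j⟩ := p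
        refine Fin.cases ?_ (fun j => Fin.cases ?_ (fun k => ?_) j) j
        · by_cases hi : i = 0 <;> simp [unshiftHom, hi]
        · by_cases hi : i = 1 <;> simp [unshiftHom, hi]
        · simp [unshiftHom]
      simpa using DFunLike.congr_fun this a)

@[simp] theorem shiftEquiv_X : shiftEquiv K m X = MvPolynomial.X (Sum.inr (Sum.inr none)) := by
  simp [shiftEquiv]

@[simp] theorem shiftEquiv_C (a : MatCoordRing K (m + 3)) :
    shiftEquiv K m (C a) = MvPolynomial.aeval (shiftEntry K) a := by
  simp [shiftEquiv]

theorem shiftEquiv_symm_apply (a : ShiftRing K m) :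
    (shiftEquiv K m).symm a = unshiftHom K m a := rfl

@[simp] theorem shiftEquiv_symm_x (i : Fin (m + 3)) :
    (shiftEquiv K m).symm (xVar K i) = C (MvPolynomial.X (i, 0)) - if i = 0 then X else 0 := by
  simp [shiftEquiv_symm_apply, unshiftHom]

@[simp] theorem shiftEquiv_symm_y (i : Fin (m + 3)) :
    (shiftEquiv K m).symm (yVar K i) = C (MvPolynomial.X (i, 1)) - if i = 1 then X else 0 := by
  simp [shiftEquiv_symm_apply, unshiftHom]

/-- The ideal of `A[λ]` corresponding to `slopeIdeal`. -/
noncomputable def eigenIdeal (S : Finset (Fin (m + 3))) : Ideal (MatCoordRing K (m + 3))[X] :=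
  (slopeIdeal K _ S).comap (shiftEquiv K m)

instance (S : Finset (Fin (m + 3))) : (eigenIdeal K m S).IsPrime :=
  Ideal.comap_isPrime _ _

theorem mem_eigenIdeal {S : Finset (Fin (m + 3))} {f : (MatCoordRing K (m + 3))[X]} :
    f ∈ eigenIdeal K m S ↔ shiftEquiv K m f ∈ slopeIdeal K _ S := Iff.rfl

theorem shiftEquiv_symm_mem_eigenIdeal {S : Finset (Fin (m + 3))} {f : ShiftRing K m} :
    (shiftEquiv K m).symm f ∈ eigenIdeal K m S ↔ f ∈ slopeIdeal K _ S := by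
  rw [mem_eigenIdeal, RingEquiv.apply_symm_apply]

/-- The ideal of `A[λ]` corresponding to `xIdeal`. -/
noncomputable def columnIdeal (S : Finset (Fin (m + 3))) : Ideal (MatCoordRing K (m + 3))[X] :=
  (xIdeal K _ S).comap (shiftEquiv K m)

theorem eigenIdeal_le_columnIdeal (S : Finset (Fin (m + 3))) :
    eigenIdeal K m S ≤ columnIdeal K m S :=
  Ideal.comap_mono (slopeIdeal_le_xIdeal S)

/-- The characteristic polynomial of the upper left `2 × 2` block. -/
noncomputable def charQuadratic : (MatCoordRing K (m + 3))[X] :=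
  X ^ 2 - C (MvPolynomial.X (0, 0) + MvPolynomial.X (1, 1)) * X +
    C (MvPolynomial.X (0, 0) * MvPolynomial.X (1, 1) -
      MvPolynomial.X (0, 1) * MvPolynomial.X (1, 0))

theorem charQuadratic_eq : charQuadratic K m = X ^ 2 +
    (C (-(MvPolynomial.X (0, 0) + MvPolynomial.X (1, 1))) * X +
    C (MvPolynomial.X (0, 0) * MvPolynomial.X (1, 1) -
      MvPolynomial.X (0, 1) * MvPolynomial.X (1, 0))) := by
  rw [charQuadratic, C_neg]
  ring

theorem monic_charQuadratic : (charQuadratic K m).Monic := by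
  rw [charQuadratic_eq]
  exact monic_X_pow_add (degree_linear_lt)

theorem degree_charQuadratic : (charQuadratic K m).degree = 2 := by
  rw [charQuadratic_eq, degree_add_eq_left_of_degree_lt] <;> rw [degree_X_pow]
  · rfl
  · exact degree_linear_lt

theorem eigenIdeal_pair : eigenIdeal K m {1, 0} = Ideal.span {charQuadratic K m} := by
  rw [eigenIdeal, slopeIdeal_pair (by simp), ← Ideal.map_symm, Ideal.map_span, Set.image_singleton,
    ← Ideal.span_singleton_neg]
  congr 2
  rw [minor, map_sub, map_mul, map_mul, shiftEquiv_symm_x, shiftEquiv_symm_y, shiftEquiv_symm_x,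
    shiftEquiv_symm_y, charQuadratic]
  simp
  ring

theorem columnIdeal_eq_span (S : Finset (Fin (m + 3))) : columnIdeal K m S =
    Ideal.span ((fun i => C (MvPolynomial.X (i, 0)) - if i = 0 then X else 0) '' (S : Set _)) := by
  rw [columnIdeal, xIdeal_eq_span, ← Ideal.map_symm, Ideal.map_span, Set.image_image,
    Set.image_image]
  congr 1
  exact Set.image_congr fun i _ => shiftEquiv_symm_x K m i

theorem pdLT_quotient_columnIdeal {S : Finset (Fin (m + 3))} (hS : 0 ∈ S) :
    PdLT (MatCoordRing K (m + 3)) ((MatCoordRing K (m + 3))[X] ⧸ columnIdeal K m S) S.card := by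
  classical
  let V : Finset (Fin (m + 3) × Fin (m + 3)) := (S.erase 0).image fun i => (i, 0)
  have hV : V.card + 1 = S.card := by
    rw [Finset.card_image_of_injective _ (Prod.mk_left_injective 0), Finset.card_erase_add_one hS]
  have key := pdLT_quotient_span_X (K := K) V
  rw [hV] at key
  set I : Ideal (MatCoordRing K (m + 3)) := Ideal.span (MvPolynomial.X '' (V : Set _)) with hI
  let φ : (MatCoordRing K (m + 3))[X] →ₐ[MatCoordRing K (m + 3)] MatCoordRing K (m + 3) ⧸ I :=
    aeval (Ideal.Quotient.mk I (MvPolynomial.X (0, 0)))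
  have hφ : Function.Surjective φ := fun b => by
    obtain ⟨b, rfl⟩ := Ideal.Quotient.mk_surjective b
    exact ⟨C b, by simp [φ]⟩
  have hker : RingHom.ker φ = columnIdeal K m S := by
    rw [columnIdeal_eq_span]
    apply le_antisymm
    · intro f hf
      have h1 : Ideal.Quotient.mk I (f.eval (MvPolynomial.X (0, 0))) = 0 := by
        rw [← hf]
        exact (aeval_algebraMap_apply_eq_algebraMap_eval _ _).symm
      have h2 : I ≤ (Ideal.span ((fun i => C (MvPolynomial.X (i, 0)) - if i = 0 then X else 0) ''
          (S : Set _))).comap (C : MatCoordRing K (m + 3) →+* _) := by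
        rw [hI, Ideal.span_le]
        rintro _ ⟨p, hp, rfl⟩
        obtain ⟨i, hi, rfl⟩ := Finset.mem_image.1 hp
        rw [Finset.mem_erase] at hi
        exact Ideal.subset_span ⟨i, hi.2, by simp [hi.1]⟩
      have h3 := h2 (Ideal.Quotient.eq_zero_iff_mem.1 h1)
      obtain ⟨g, hg⟩ := X_sub_C_dvd_sub_C_eval (a := MvPolynomial.X (0, 0)) (p := f)
      rw [sub_eq_iff_eq_add.1 hg]
      refine add_mem (Ideal.mul_mem_right _ _ ?_) h3
      rw [← neg_sub, Ideal.neg_mem_iff]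
      exact Ideal.subset_span ⟨0, hS, by simp⟩
    · rw [Ideal.span_le]
      rintro _ ⟨i, hi, rfl⟩
      by_cases h0 : i = 0
      · simp [φ, h0]
      · have : Ideal.Quotient.mk I (MvPolynomial.X (i, 0)) = 0 :=
          Ideal.Quotient.eq_zero_iff_mem.2 (Ideal.subset_span ⟨_, Finset.mem_coe.2
            (Finset.mem_image.2 ⟨i, Finset.mem_erase.2 ⟨h0, hi⟩, rfl⟩), rfl⟩)
        simp [φ, h0, this]
  exact key.of_equiv ((Ideal.quotientEquivAlgOfEq _ hker.symm).trans
    (Ideal.quotientKerAlgEquivOfSurjective hφ)).symm.toLinearEquiv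

theorem pdLT_quotient_eigenIdeal {S : Finset (Fin (m + 3))} (h0 : 0 ∉ S) (h1 : 1 ∉ S) :
    PdLT (MatCoordRing K (m + 3)) ((MatCoordRing K (m + 3))[X] ⧸ eigenIdeal K m (S ∪ {1, 0}))
      (S.card + 1) := by
  induction S using Finset.induction_on with
  | empty =>
    rw [Finset.empty_union, eigenIdeal_pair]
    have := (monic_charQuadratic K m).free_quotient
    exact PdLT.of_projective
  | insert r S hr ih =>
    have hS0 : 0 ∉ S := fun h => h0 (Finset.mem_insert_of_mem h)
    have hS1 : 1 ∉ S := fun h => h1 (Finset.mem_insert_of_mem h)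
    have hr0 : r ≠ 0 := by rintro rfl; exact h0 (Finset.mem_insert_self _ _)
    have hr1 : r ≠ 1 := by rintro rfl; exact h1 (Finset.mem_insert_self _ _)
    have hr' : r ∉ S ∪ {1, 0} := by simp [hr, hr0, hr1]
    have hs : (0 : Fin (m + 3)) ∈ S ∪ {1, 0} := by simp
    rw [Finset.insert_union, Finset.card_insert_of_notMem hr]
    have hsurj (q : ShiftRing K m) := (shiftEquiv K m).apply_symm_apply q
    refine pdLT_quotient_of_mul_eq (J := eigenIdeal K m (S ∪ {1, 0}))
      (Q := columnIdeal K m (S ∪ {1, 0})) (x := (shiftEquiv K m).symm (xVar K 0))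
      (z := (shiftEquiv K m).symm (minor K _ 0 r))
      (Ideal.comap_mono (slopeIdeal_le_insert hr')) (eigenIdeal_le_columnIdeal K m _) ?_ ?_ ?_ ?_
      (ih hS0 hS1) ?_
    · rw [shiftEquiv_symm_mem_eigenIdeal]
      exact xVar_notMem_slopeIdeal hs
    · rw [shiftEquiv_symm_mem_eigenIdeal]
      exact minor_notMem_slopeIdeal hs hr'
    · intro q hq
      obtain ⟨i, hi, h⟩ := exists_mem_slopeIdeal_insert hs hr' hq
      refine ⟨(shiftEquiv K m).symm i, (shiftEquiv_symm_mem_eigenIdeal K m).2 hi, ?_⟩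
      rw [mem_eigenIdeal, map_sub, map_mul, map_mul, hsurj, hsurj, hsurj]
      exact h
    · intro i hi
      obtain ⟨q, hq, h⟩ := exists_mem_xIdeal hs hr' hi
      refine ⟨(shiftEquiv K m).symm q, ?_, ?_⟩
      · rw [columnIdeal, Ideal.mem_comap, hsurj]
        exact hq
      · rw [mem_eigenIdeal, map_sub, map_mul, map_mul, hsurj, hsurj, hsurj]
        exact h
    · have hcard : (S ∪ {1, 0}).card = S.card + 1 + 1 := by
        rw [Finset.card_union_of_disjoint, Finset.card_pair (by simp)]
        simp [hS0, hS1]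
      rw [← hcard]
      exact pdLT_quotient_columnIdeal K m hs

end Transport

section Points

open Polynomial

variable {K : Type*} [Field K] {ι ρ : Type} [DecidableEq ι]

theorem eval_slopeHom (S : Finset ι) (a : ι ⊕ ι ⊕ ρ → K) (t : K) (f : PairRing K ι ρ) :
    ((slopeHom K S f).map (MvPolynomial.eval a)).eval t =
      MvPolynomial.eval (Sum.elim (fun j => if j ∈ S then a (Sum.inr (Sum.inl j)) * t else
        a (Sum.inl j)) fun k => a (Sum.inr k)) f := by
  induction f using MvPolynomial.induction_on with
  | C c =>
    rw [MvPolynomial.algHom_C, IsScalarTower.algebraMap_apply K (PairRing K ι ρ), algebraMap_eq,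
      map_C, eval_C, MvPolynomial.algebraMap_eq, MvPolynomial.eval_C, MvPolynomial.eval_C]
  | add p q hp hq => rw [map_add, Polynomial.map_add, eval_add, hp, hq, map_add]
  | mul_X p v hp =>
    rw [map_mul, Polynomial.map_mul, eval_mul, hp, map_mul]
    congr 1
    rcases v with j | k
    · by_cases hj : j ∈ S
      · rw [slopeHom_x_of_mem hj]
        simp [hj]
      · rw [slopeHom_x_of_notMem hj]
        simp [hj]
    · simp

variable [Fintype ι]

theorem eval_eq_zero_of_eq_mul {f : PairRing K ι ρ} (hf : f ∈ slopeIdeal K ρ Finset.univ)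
    {a : ι ⊕ ι ⊕ ρ → K} {t : K} (h : ∀ i, a (Sum.inl i) = a (Sum.inr (Sum.inl i)) * t) :
    MvPolynomial.eval a f = 0 := by
  have := eval_slopeHom Finset.univ a t f
  rw [mem_slopeIdeal.1 hf, Polynomial.map_zero, eval_zero] at this
  rw [this]
  congr 2
  funext v
  rcases v with i | k <;> simp [h]

theorem mem_slopeIdeal_of_eval_eq_zero [Infinite K] {f : PairRing K ι ρ}
    (hf : ∀ (a : ι ⊕ ι ⊕ ρ → K) (t : K), (∀ i, a (Sum.inl i) = a (Sum.inr (Sum.inl i)) * t) →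
      MvPolynomial.eval a f = 0) : f ∈ slopeIdeal K ρ Finset.univ := by
  rw [mem_slopeIdeal]
  ext1 k
  refine MvPolynomial.funext fun a => ?_
  have : (slopeHom K Finset.univ f).map (MvPolynomial.eval a) = 0 := by
    refine Polynomial.funext fun t => ?_
    rw [eval_slopeHom, eval_zero]
    exact hf _ t fun i => by simp
  simpa using congrArg (fun p => p.coeff k) this

/-- Relations between proportional columns vanish at every pair of linearly dependent columns. -/
theorem eval_eq_zero_of_mem_slopeIdeal [Infinite K] {f : PairRing K ι ρ}
    (hf : f ∈ slopeIdeal K ρ Finset.univ) {a : ι ⊕ ι ⊕ ρ → K} {b c : K} (hbc : b ≠ 0 ∨ c ≠ 0)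
    (h : ∀ i, a (Sum.inl i) * b + a (Sum.inr (Sum.inl i)) * c = 0) :
    MvPolynomial.eval a f = 0 := by
  by_cases hb : b = 0
  · have hc : c ≠ 0 := hbc.resolve_left (not_not.2 hb)
    have hy (i) : a (Sum.inr (Sum.inl i)) = 0 := by simpa [hb, hc] using h i
    let φ : PairRing K ι ρ →ₐ[K] K[X] := MvPolynomial.aeval
      (Sum.elim (fun i => C (a (Sum.inl i))) (Sum.elim (fun i => C (a (Sum.inl i)) * X)
        fun k => C (a (Sum.inr (Sum.inr k)))))
    have hφ (f) (s : K) : (φ f).eval s = MvPolynomial.eval (Sum.elim (fun i => a (Sum.inl i))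
        (Sum.elim (fun i => a (Sum.inl i) * s) fun k => a (Sum.inr (Sum.inr k)))) f := by
      induction f using MvPolynomial.induction_on with
      | C c => simp
      | add p q hp hq => simp [hp, hq]
      | mul_X p v hp =>
        rw [map_mul, eval_mul, hp, map_mul]
        congr 1
        rcases v with i | i | k <;> simp [φ]
    have h0 : φ f * X = 0 := by
      refine Polynomial.funext fun s => ?_
      by_cases hs : s = 0
      · simp [hs]
      · rw [eval_mul, hφ f, eval_eq_zero_of_eq_mul hf (t := s⁻¹), zero_mul, eval_zero]
        intro i
        simp [hs]
    have h1 := (mul_eq_zero.1 h0).resolve_right X_ne_zero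
    have h2 := hφ f 0
    rw [h1, eval_zero] at h2
    rw [h2]
    congr 2
    funext v
    rcases v with i | i | k <;> simp [hy]
  · refine eval_eq_zero_of_eq_mul hf (t := -c / b) fun i => ?_
    field_simp
    linear_combination h i

end Points

section Kalman

open Polynomial

variable (K : Type u) [Field K] (m : ℕ)

theorem eval_shiftEquiv_C (a : Fin (m + 3) ⊕ Fin (m + 3) ⊕ Option (Fin (m + 3) × Fin (m + 1)) → K)
    (f : MatCoordRing K (m + 3)) : MvPolynomial.eval a (shiftEquiv K m (C f)) =
      MvPolynomial.eval (fun p => MvPolynomial.eval a (shiftEntry K p)) f := by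
  rw [shiftEquiv_C]
  induction f using MvPolynomial.induction_on with
  | C c => simp
  | add p q hp hq => rw [map_add, map_add, map_add, hp, hq]
  | mul_X p v hp => rw [map_mul, map_mul, map_mul, hp, MvPolynomial.aeval_X, MvPolynomial.eval_X]

variable {m} in
theorem mulVec_eq_of_mem_firstCoordsSubspace (M : Matrix (Fin (m + 3)) (Fin (m + 3)) K)
    {w : Fin (m + 3) → K} (hw : w ∈ firstCoordsSubspace K (m + 3) 2) (i : Fin (m + 3)) :
    M.mulVec w i = M i 0 * w 0 + M i 1 * w 1 := by
  rw [Matrix.mulVec, dotProduct, Fin.sum_univ_succ, Fin.sum_univ_succ, Finset.sum_eq_zero, add_zero]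
  · rfl
  · intro k _
    rw [hw k.succ.succ (by simp), mul_zero]

variable {m} in
theorem eq_ite_add_ite_of_mem_firstCoordsSubspace {w : Fin (m + 3) → K}
    (hw : w ∈ firstCoordsSubspace K (m + 3) 2) (i : Fin (m + 3)) :
    w i = (if i = 0 then w 0 else 0) + (if i = 1 then w 1 else 0) := by
  refine Fin.cases ?_ (fun j => Fin.cases ?_ (fun k => ?_) j) i
  · simp
  · simp
  · rw [hw k.succ.succ (by simp), if_neg (Fin.succ_ne_zero _), if_neg, add_zero]
    exact fun h => Fin.succ_ne_zero _ (Fin.succ_injective _ h)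

variable {m} in
theorem mem_kalmanSet_iff (M : Matrix (Fin (m + 3)) (Fin (m + 3)) K) :
    M ∈ kalmanSet K (m + 3) 2 1 ↔
      ∃ b c l : K, (b ≠ 0 ∨ c ≠ 0) ∧ ∀ i : Fin (m + 3), (M i 0 - if i = 0 then l else 0) * b +
        (M i 1 - if i = 1 then l else 0) * c = 0 := by
  constructor
  · rintro ⟨U, hU, hrank, hM⟩
    obtain ⟨⟨w, hwU⟩, hw, hspan⟩ := finrank_eq_one_iff'.1 hrank
    obtain ⟨l, hl⟩ := hspan ⟨_, hM _ hwU⟩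
    have hsplit := eq_ite_add_ite_of_mem_firstCoordsSubspace K (hU hwU)
    have hl (i) : l * w i = M i 0 * w 0 + M i 1 * w 1 :=
      (congrFun (congrArg Subtype.val hl) i).trans
        (mulVec_eq_of_mem_firstCoordsSubspace K M (hU hwU) i)
    refine ⟨w 0, w 1, l, ?_, fun i => ?_⟩
    · by_contra! h
      refine hw (Subtype.ext (funext fun i => ?_))
      simpa [h] using hsplit i
    · have h := hl i
      rw [hsplit i] at h
      split_ifs at h ⊢ <;> linear_combination -h
  · rintro ⟨b, c, l, hbc, h⟩
    let w : Fin (m + 3) → K := Fin.cases b (Fin.cases c fun _ => 0)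
    have hwL : w ∈ firstCoordsSubspace K (m + 3) 2 := by
      intro i
      refine Fin.cases ?_ (fun j => Fin.cases ?_ (fun k => ?_) j) i
      · simp
      · simp
      · exact fun _ => rfl
    have hw0 : w ≠ 0 := fun e => hbc.elim (fun hb => hb (congrFun e 0)) fun hc => hc (congrFun e 1)
    refine ⟨K ∙ w, ?_, finrank_span_singleton hw0, ?_⟩
    · rwa [Submodule.span_singleton_le_iff_mem]
    · intro v hv
      obtain ⟨s, rfl⟩ := Submodule.mem_span_singleton.1 hv
      rw [Matrix.mulVec_smul]
      refine Submodule.smul_mem _ _ (Submodule.mem_span_singleton.2 ⟨l, funext fun i => ?_⟩)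
      rw [mulVec_eq_of_mem_firstCoordsSubspace K M hwL, Pi.smul_apply, smul_eq_mul,
        eq_ite_add_ite_of_mem_firstCoordsSubspace K hwL i]
      change l * ((if i = 0 then b else 0) + (if i = 1 then c else 0)) = M i 0 * b + M i 1 * c
      have h := h i
      split_ifs at h ⊢ <;> linear_combination -h

theorem mem_kalmanIdeal_iff [Infinite K] (f : MatCoordRing K (m + 3)) :
    f ∈ kalmanIdeal K (m + 3) 2 1 ↔ C f ∈ eigenIdeal K m Finset.univ := by
  rw [mem_eigenIdeal]
  constructor
  · intro hf
    refine mem_slopeIdeal_of_eval_eq_zero fun a t h => ?_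
    rw [eval_shiftEquiv_C]
    refine hf (fun i j => MvPolynomial.eval a (shiftEntry K (i, j)))
      ((mem_kalmanSet_iff K _).2 ?_)
    refine ⟨1, -t, a (Sum.inr (Sum.inr none)), Or.inl one_ne_zero, fun i => ?_⟩
    have h1 := h i
    rw [shiftEntry_zero, shiftEntry_one, map_add, map_add, apply_ite (MvPolynomial.eval a),
      apply_ite (MvPolynomial.eval a)]
    simp only [MvPolynomial.eval_X, map_zero, add_sub_cancel_right]
    rw [h1]
    ring
  · intro hf M hM
    obtain ⟨b, c, l, hbc, h⟩ := (mem_kalmanSet_iff K M).1 hM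
    let a : Fin (m + 3) ⊕ Fin (m + 3) ⊕ Option (Fin (m + 3) × Fin (m + 1)) → K :=
      Sum.elim (fun i => M i 0 - if i = 0 then l else 0)
        (Sum.elim (fun i => M i 1 - if i = 1 then l else 0)
          fun o => o.elim l fun p => M p.1 p.2.succ.succ)
    have := eval_eq_zero_of_mem_slopeIdeal hf (a := a) hbc h
    rw [eval_shiftEquiv_C] at this
    rw [← this]
    congr 2
    funext p
    obtain ⟨i, j⟩ := p
    refine Fin.cases ?_ (fun j => Fin.cases ?_ (fun k => ?_) j) j
    · rw [shiftEntry_zero]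
      by_cases hi : i = 0 <;> simp [a, hi]
    · change M i 1 = MvPolynomial.eval a (shiftEntry K (i, 1))
      rw [shiftEntry_one]
      by_cases hi : i = 1 <;> simp [a, hi]
    · simp [a]

end Kalman

section Restrict

open Polynomial

variable (K : Type*) [Field K] {ι ρ : Type} [DecidableEq ι]

/-- The substitution `x i ↦ 0`, `y i ↦ 0` for `i ∉ S`, fixing all the other variables. -/
noncomputable def restrictHom (S : Finset ι) : PairRing K ι ρ →ₐ[K] PairRing K ι ρ :=
  MvPolynomial.aeval (Sum.elim (fun i => if i ∈ S then xVar K i else 0)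
    (Sum.elim (fun i => if i ∈ S then yVar K i else 0) fun k =>
      MvPolynomial.X (Sum.inr (Sum.inr k))))

theorem slopeHom_restrictHom [Fintype ι] (S : Finset ι) (f : PairRing K ι ρ) :
    slopeHom K S (restrictHom K S f) =
      mapAlgHom (restrictHom K S) (slopeHom K Finset.univ f) := by
  have : (slopeHom K S).comp (restrictHom K S) =
      (mapAlgHom (restrictHom K S)).comp (slopeHom (ρ := ρ) K Finset.univ) := by
    refine MvPolynomial.algHom_ext fun v => ?_
    rcases v with i | i | k
    · by_cases hi : i ∈ S <;> simp [restrictHom, hi]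
    · by_cases hi : i ∈ S <;> simp [restrictHom, hi]
    · simp [restrictHom]
  exact DFunLike.congr_fun this f

theorem restrictHom_mem_slopeIdeal [Fintype ι] {S : Finset ι} {f : PairRing K ι ρ}
    (hf : f ∈ slopeIdeal K ρ Finset.univ) : restrictHom K S f ∈ slopeIdeal K ρ S := by
  rw [mem_slopeIdeal, slopeHom_restrictHom, mem_slopeIdeal.1 hf, map_zero]

theorem minor_mem_slopeIdeal_univ [Fintype ι] (s r : ι) :
    minor K ρ s r ∈ slopeIdeal K ρ Finset.univ := by
  rw [mem_slopeIdeal, minor, map_sub, map_mul, map_mul, slopeHom_x_of_mem (Finset.mem_univ _),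
    slopeHom_x_of_mem (Finset.mem_univ _), slopeHom_inr, slopeHom_inr]
  ring

end Restrict

section Cokernel

open Polynomial

variable (K : Type u) [Field K] (m : ℕ)

/-- The positions of the entries of the lower left block. -/
def gammaVars : Finset (Fin (m + 3) × Fin (m + 3)) :=
  (Finset.univ \ {1, 0}) ×ˢ {0, 1}

theorem card_univ_sdiff : (Finset.univ \ {1, 0} : Finset (Fin (m + 3))).card = m + 1 := by
  rw [Finset.card_sdiff_of_subset (Finset.subset_univ _), Finset.card_pair (by simp),
    Finset.card_univ, Fintype.card_fin]
  rfl

theorem card_gammaVars : (gammaVars m).card = 2 * m + 2 := by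
  rw [gammaVars, Finset.card_product, card_univ_sdiff, Finset.card_pair (by simp)]
  ring

/-- The ideal generated by the entries of the lower left block. -/
noncomputable def gammaIdeal : Ideal (MatCoordRing K (m + 3)) :=
  Ideal.span (MvPolynomial.X '' (gammaVars m : Set _))

/-- The substitution of zero for the entries of the lower left block. -/
noncomputable def killGamma : MatCoordRing K (m + 3) →ₐ[K] MatCoordRing K (m + 3) :=
  MvPolynomial.aeval fun p => if p ∈ gammaVars m then 0 else MvPolynomial.X p

theorem mem_gammaIdeal_of_killGamma_eq_zero {f : MatCoordRing K (m + 3)}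
    (hf : killGamma K m f = 0) : f ∈ gammaIdeal K m := by
  have := sub_mem_span_of_forall_X (killGamma K m) (gammaIdeal K m) (fun p => ?_) f
  · rwa [hf, sub_zero] at this
  · by_cases hp : p ∈ gammaVars m
    · simp only [killGamma, MvPolynomial.aeval_X, hp, if_true, sub_zero]
      exact Ideal.subset_span ⟨p, hp, rfl⟩
    · simp only [killGamma, MvPolynomial.aeval_X, hp, if_false, sub_self]
      exact zero_mem _

theorem shiftEquiv_map_killGamma (f : (MatCoordRing K (m + 3))[X]) :
    shiftEquiv K m (mapAlgHom (killGamma K m) f) = restrictHom K {1, 0} (shiftEquiv K m f) := by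
  have : (RingEquiv.toRingHom (shiftEquiv K m)).comp
      (mapAlgHom (killGamma K m) : _ →+* (MatCoordRing K (m + 3))[X]) =
      ((restrictHom K {1, 0} : ShiftRing K m →ₐ[K] ShiftRing K m) :
        ShiftRing K m →+* ShiftRing K m).comp
        (RingEquiv.toRingHom (shiftEquiv K m)) := by
    refine Polynomial.ringHom_ext (fun a => ?_) (by simp [restrictHom])
    have h : (MvPolynomial.aeval (shiftEntry K)).comp (killGamma K m) =
        (restrictHom K {1, 0}).comp (MvPolynomial.aeval (shiftEntry K)) := by
      refine MvPolynomial.algHom_ext fun p => ?_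
      obtain ⟨i, j⟩ := p
      rw [AlgHom.comp_apply, AlgHom.comp_apply, killGamma, MvPolynomial.aeval_X,
        MvPolynomial.aeval_X]
      refine Fin.cases ?_ (fun j => Fin.cases ?_ (fun k => ?_) j) j
      · by_cases h0 : i = 0
        · simp [gammaVars, restrictHom, h0]
        · by_cases h1 : i = 1 <;> simp [gammaVars, restrictHom, h0, h1]
      · by_cases h0 : i = 1
        · simp [gammaVars, restrictHom, h0]
        · by_cases h1 : i = 0 <;> simp [gammaVars, restrictHom, h0, h1]
      · rw [if_neg, MvPolynomial.aeval_X, shiftEntry_succ_succ]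
        · simp [restrictHom]
        · intro hk
          rw [gammaVars, Finset.mem_product, Finset.mem_insert, Finset.mem_singleton] at hk
          exact hk.2.elim (Fin.succ_ne_zero k.succ) fun h =>
            Fin.succ_ne_zero k (Fin.succ_injective _ h)
    simpa using DFunLike.congr_fun h a
  exact DFunLike.congr_fun this f

theorem map_killGamma_charQuadratic :
    (charQuadratic K m).map (killGamma K m : _ →+* MatCoordRing K (m + 3)) = charQuadratic K m := by
  simp [charQuadratic, killGamma, gammaVars]

/-- The linear map sending `f` to the class of the coefficient of `λ` in the remainder of `f`
modulo the characteristic polynomial of the upper left block. -/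
noncomputable def remainderMap :
    (MatCoordRing K (m + 3))[X] →ₗ[MatCoordRing K (m + 3)]
      MatCoordRing K (m + 3) ⧸ gammaIdeal K m :=
  (Submodule.mkQ (gammaIdeal K m)).comp ((lcoeff _ 1).comp (modByMonicHom (charQuadratic K m)))

theorem remainderMap_eq_zero_iff {f : (MatCoordRing K (m + 3))[X]} :
    remainderMap K m f = 0 ↔ (f %ₘ charQuadratic K m).coeff 1 ∈ gammaIdeal K m :=
  Ideal.Quotient.eq_zero_iff_mem

theorem remainderMap_C (a : MatCoordRing K (m + 3)) : remainderMap K m (C a) = 0 := by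
  rw [remainderMap_eq_zero_iff, (modByMonic_eq_self_iff (monic_charQuadratic K m)).2,
    coeff_C_of_ne_zero one_ne_zero]
  · exact zero_mem _
  · rw [degree_charQuadratic]
    exact degree_C_le.trans_lt (by decide)

theorem remainderMap_surjective : Function.Surjective (remainderMap K m) := by
  intro b
  obtain ⟨b, rfl⟩ := Ideal.Quotient.mk_surjective b
  refine ⟨C b * X, ?_⟩
  have : (C b * X) %ₘ charQuadratic K m = C b * X := by
    rw [modByMonic_eq_self_iff (monic_charQuadratic K m), degree_charQuadratic]
    exact (degree_C_mul_X_le b).trans_lt (by decide)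
  change Ideal.Quotient.mk _ ((C b * X %ₘ charQuadratic K m).coeff 1) = _
  rw [this, coeff_C_mul_X, if_pos rfl]

theorem remainderMap_eq_zero_of_mem {f : (MatCoordRing K (m + 3))[X]}
    (hf : f ∈ eigenIdeal K m Finset.univ) : remainderMap K m f = 0 := by
  rw [remainderMap_eq_zero_iff]
  apply mem_gammaIdeal_of_killGamma_eq_zero
  have h1 : mapAlgHom (killGamma K m) f ∈ eigenIdeal K m {1, 0} := by
    rw [mem_eigenIdeal, shiftEquiv_map_killGamma]
    exact restrictHom_mem_slopeIdeal K hf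
  rw [eigenIdeal_pair, Ideal.mem_span_singleton,
    ← modByMonic_eq_zero_iff_dvd (monic_charQuadratic K m)] at h1
  have h2 := map_modByMonic (killGamma K m : _ →+* MatCoordRing K (m + 3)) (p := f)
    (monic_charQuadratic K m)
  rw [map_killGamma_charQuadratic] at h2
  have h3 := congrArg (fun p => p.coeff 1) (h2.trans h1)
  simpa using h3

theorem charQuadratic_mem : charQuadratic K m ∈ eigenIdeal K m Finset.univ := by
  have h : charQuadratic K m ∈ eigenIdeal K m {1, 0} := by
    rw [eigenIdeal_pair]
    exact Ideal.mem_span_singleton_self _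
  rw [mem_eigenIdeal, slopeIdeal_pair (by simp)] at h
  rw [mem_eigenIdeal]
  exact (Ideal.span_singleton_le_iff_mem _).2 (minor_mem_slopeIdeal_univ K 0 1) h

theorem exists_C_mul_X_sub_C_mem {h : MatCoordRing K (m + 3)} (hh : h ∈ gammaIdeal K m) :
    ∃ a, C h * X - C a ∈ eigenIdeal K m Finset.univ := by
  have hminor (s r : Fin (m + 3)) :
      (shiftEquiv K m).symm (minor K _ s r) ∈ eigenIdeal K m Finset.univ :=
    (shiftEquiv_symm_mem_eigenIdeal K m).2 (minor_mem_slopeIdeal_univ K s r)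
  simp only [minor, map_sub, map_mul, shiftEquiv_symm_x, shiftEquiv_symm_y] at hminor
  induction hh using Submodule.span_induction with
  | mem h hh =>
    obtain ⟨⟨i, j⟩, hp, rfl⟩ := hh
    simp only [gammaVars, Finset.coe_product, Set.mem_prod, Finset.mem_coe, Finset.mem_sdiff,
      Finset.mem_univ, true_and, Finset.mem_insert, Finset.mem_singleton, not_or] at hp
    obtain ⟨⟨h1, h0⟩, rfl | rfl⟩ := hp
    · refine ⟨MvPolynomial.X (i, 0) * MvPolynomial.X (1, 1) -
        MvPolynomial.X (i, 1) * MvPolynomial.X (1, 0), ?_⟩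
      have := neg_mem (hminor 1 i)
      simp only [h1, h0, if_false, if_true, sub_zero, one_ne_zero] at this
      convert this using 1
      rw [C_sub, C_mul, C_mul]
      ring
    · refine ⟨MvPolynomial.X (i, 1) * MvPolynomial.X (0, 0) -
        MvPolynomial.X (i, 0) * MvPolynomial.X (0, 1), ?_⟩
      have := hminor 0 i
      simp only [h1, h0, if_false, if_true, sub_zero, zero_ne_one] at this
      convert this using 1
      rw [C_sub, C_mul, C_mul]
      ring
  | zero => exact ⟨0, by simp⟩
  | add f g _ _ hf hg =>
    obtain ⟨a, ha⟩ := hf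
    obtain ⟨b, hb⟩ := hg
    refine ⟨a + b, ?_⟩
    convert add_mem ha hb using 1
    rw [C_add, C_add]
    ring
  | smul c f _ hf =>
    obtain ⟨a, ha⟩ := hf
    refine ⟨c * a, ?_⟩
    convert Ideal.mul_mem_left _ (C c) ha using 1
    rw [smul_eq_mul, C_mul, C_mul]
    ring

theorem exists_sub_C_mem {f : (MatCoordRing K (m + 3))[X]} (hf : remainderMap K m f = 0) :
    ∃ a, f - C a ∈ eigenIdeal K m Finset.univ := by
  rw [remainderMap_eq_zero_iff] at hf
  obtain ⟨a, ha⟩ := exists_C_mul_X_sub_C_mem K m hf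
  refine ⟨a + (f %ₘ charQuadratic K m).coeff 0, ?_⟩
  have h1 := Ideal.mul_mem_right (f /ₘ charQuadratic K m) _ (charQuadratic_mem K m)
  have h2 : f %ₘ charQuadratic K m = C ((f %ₘ charQuadratic K m).coeff 1) * X +
      C ((f %ₘ charQuadratic K m).coeff 0) := by
    refine eq_X_add_C_of_degree_le_one ?_
    have := degree_modByMonic_lt f (monic_charQuadratic K m)
    rw [degree_charQuadratic] at this
    exact Order.le_of_lt_succ this
  convert add_mem h1 ha using 1
  rw [C_add]
  linear_combination -modByMonic_add_div f (charQuadratic K m) + h2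

/-- The inclusion of the coordinate ring of the Kalman variety into `A[λ] / J`. -/
noncomputable def kalmanToEigen [Infinite K] :
    KalmanCoordRing K (m + 3) 2 1 →ₗ[MatCoordRing K (m + 3)]
      (MatCoordRing K (m + 3))[X] ⧸ eigenIdeal K m Finset.univ :=
  Submodule.liftQ (kalmanIdeal K (m + 3) 2 1)
    ((Ideal.Quotient.mkₐ (MatCoordRing K (m + 3)) (eigenIdeal K m Finset.univ)).comp
      CAlgHom).toLinearMap
    fun f hf => Ideal.Quotient.eq_zero_iff_mem.2 ((mem_kalmanIdeal_iff K m f).1 hf)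

theorem kalmanToEigen_injective [Infinite K] : Function.Injective (kalmanToEigen K m) := by
  rw [injective_iff_map_eq_zero]
  intro f hf
  obtain ⟨f, rfl⟩ := Ideal.Quotient.mk_surjective f
  exact Ideal.Quotient.eq_zero_iff_mem.2
    ((mem_kalmanIdeal_iff K m f).2 (Ideal.Quotient.eq_zero_iff_mem.1 hf))

/-- The map from `A[λ] / J` onto the quotient by the entries of the lower left block. -/
noncomputable def eigenToGamma : ((MatCoordRing K (m + 3))[X] ⧸ eigenIdeal K m Finset.univ)
    →ₗ[MatCoordRing K (m + 3)] MatCoordRing K (m + 3) ⧸ gammaIdeal K m :=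
  (Submodule.liftQ ((eigenIdeal K m Finset.univ).restrictScalars (MatCoordRing K (m + 3)))
    (remainderMap K m) fun _ hf => remainderMap_eq_zero_of_mem K m hf).comp
    (Submodule.Quotient.restrictScalarsEquiv _ _).symm.toLinearMap

theorem eigenToGamma_mk (f : (MatCoordRing K (m + 3))[X]) :
    eigenToGamma K m (Ideal.Quotient.mk _ f) = remainderMap K m f := rfl

theorem eigenToGamma_surjective : Function.Surjective (eigenToGamma K m) := fun b => by
  obtain ⟨f, rfl⟩ := remainderMap_surjective K m b
  exact ⟨_, eigenToGamma_mk K m f⟩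

theorem exact_kalmanToEigen_eigenToGamma [Infinite K] :
    Function.Exact (kalmanToEigen K m) (eigenToGamma K m) := by
  intro f
  obtain ⟨f, rfl⟩ := Ideal.Quotient.mk_surjective f
  rw [eigenToGamma_mk]
  constructor
  · intro hf
    obtain ⟨a, ha⟩ := exists_sub_C_mem K m hf
    exact ⟨Ideal.Quotient.mk _ a, ((Ideal.Quotient.mk_eq_mk_iff_sub_mem _ _).2 ha).symm⟩
  · rintro ⟨a, ha⟩
    obtain ⟨a, rfl⟩ := Ideal.Quotient.mk_surjective a
    rw [← eigenToGamma_mk, ← ha]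
    exact remainderMap_C K m a

theorem pdLT_quotient_eigenIdeal_univ : PdLT (MatCoordRing K (m + 3))
    ((MatCoordRing K (m + 3))[X] ⧸ eigenIdeal K m Finset.univ) (m + 2) := by
  have := pdLT_quotient_eigenIdeal K m (S := Finset.univ \ {1, 0}) (by simp) (by simp)
  rwa [card_univ_sdiff, Finset.sdiff_union_of_subset (Finset.subset_univ _)] at this

end Cokernel

theorem stmt8 (K : Type u) [Field K] [IsAlgClosed K] (n : ℕ) (hn : 3 ≤ n) :
    projDimEq (MatCoordRing K n) (KalmanCoordRing K n 2 1) (2 * n - 5) := by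
  obtain ⟨m, rfl⟩ := Nat.exists_eq_add_of_le' hn
  have := IsAlgClosed.instInfinite (K := K)
  have hEigen := (pdLT_quotient_eigenIdeal_univ K m).mono (by omega : m + 2 ≤ 2 * m + 2)
  have hGamma := pdLT_quotient_span_X (K := K) (gammaVars m)
  have hGamma' := not_pdLT_quotient_span_X (K := K) (gammaVars m)
  rw [card_gammaVars] at hGamma hGamma'
  have hexact := exact_kalmanToEigen_eigenToGamma K m
  have hinj := kalmanToEigen_injective K m
  have hsurj := eigenToGamma_surjective K m
  rw [show 2 * (m + 3) - 5 = 2 * m + 1 by omega]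
  refine ⟨(projDimLE_iff_pdLT _ _).2 (PdLT.left hexact hinj hsurj hEigen hGamma), fun l hl => ?_⟩
  by_contra! hlt
  exact hGamma' (PdLT.right hexact hinj hsurj
    (((projDimLE_iff_pdLT _ _).1 hl).mono (by omega : l + 1 ≤ 2 * m + 1)) hEigen)
end

section
/- Let K be an algebraically closed field and n ≥ 3. The vanishing ideal I_{1,2,n} of the Kalman variety K_{1,2,n} is minimally generated by C(n−2,2) homogeneous polynomials of degree 2 and C(n−1,2) homogeneous polynomials of degree 3. Precisely: dim_K (I_{1,2,n})_2 − dim_K (A₊·I_{1,2,n})_2 = C(n−2,2), dim_K (I_{1,2,n})_3 − dim_K (A₊·I_{1,2,n})_3 = C(n−1,2), and dim_K (I_{1,2,n})_j − dim_K (A₊·I_{1,2,n})_j = 0 for every other j ≥ 0. Here C(a,b) denotes the binomial coefficient. -/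
set_option synthInstance.maxHeartbeats 1000000
set_option maxHeartbeats 4000000

open Matrix

/-- The degree-`j` graded piece of a (homogeneous) ideal `J ⊆ A`, as a
`K`-subspace of `A`. -/
noncomputable def gradedPiece (K : Type*) [Field K] (n : ℕ)
    (J : Ideal (MatCoordRing K n)) (j : ℕ) : Submodule K (MatCoordRing K n) :=
  Submodule.restrictScalars K J ⊓ MvPolynomial.homogeneousSubmodule (Fin n × Fin n) K j

section GeneratorCount

attribute [local instance] MvPolynomial.gradedAlgebra

open MvPolynomial

variable {K : Type*} [Field K] {n : ℕ}

theorem sub_C_coeff_zero_mem_irrelevantIdeal (p : MatCoordRing K n) :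
    p - C (coeff 0 p) ∈ irrelevantIdeal K n := by
  induction p using MvPolynomial.induction_on with
  | C a => simp
  | add p q hp hq =>
    have := add_mem hp hq
    rw [coeff_add, map_add]
    convert this using 1
    ring
  | mul_X p s _ =>
    have h : coeff 0 (p * X s) = 0 := by simp [coeff_mul_X']
    rw [h, map_zero, sub_zero]
    exact Ideal.mul_mem_left _ _ (Ideal.subset_span ⟨s, rfl⟩)

theorem coeff_zero_of_mem_irrelevantIdeal {p : MatCoordRing K n}
    (hp : p ∈ irrelevantIdeal K n) : coeff 0 p = 0 := by
  have h : irrelevantIdeal K n ≤ RingHom.ker (constantCoeff (R := K) (σ := Fin n × Fin n)) := by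
    rw [irrelevantIdeal, Ideal.span_le]
    rintro _ ⟨s, rfl⟩
    simp
  exact h hp

variable {G : Type*} {gen : G → MatCoordRing K n}

theorem coeff_eq_zero_of_mem_span_of_lt {E : (Fin n × Fin n) →₀ ℕ}
    (hlt : ∀ g, ∀ e < E, coeff e (gen g) = 0) {f : MatCoordRing K n}
    (hf : f ∈ Ideal.span (Set.range gen)) : ∀ e < E, coeff e f = 0 := by
  classical
  induction hf using Submodule.span_induction with
  | mem x hx => obtain ⟨g, rfl⟩ := hx; exact hlt g
  | zero => simp
  | add x y _ _ hx hy => intro e he; simp [hx e he, hy e he]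
  | smul a x _ hx =>
    intro e he
    rw [smul_eq_mul, coeff_mul]
    refine Finset.sum_eq_zero fun p hp => ?_
    rw [hx p.2 (lt_of_le_of_lt ?_ he), mul_zero]
    rw [← Finset.HasAntidiagonal.mem_antidiagonal.1 hp]
    exact le_add_self

theorem coeff_eq_zero_of_mem_irrelevantIdeal_mul {E : (Fin n × Fin n) →₀ ℕ}
    (hlt : ∀ g, ∀ e < E, coeff e (gen g) = 0) {f : MatCoordRing K n}
    (hf : f ∈ irrelevantIdeal K n * Ideal.span (Set.range gen)) : coeff E f = 0 := by
  classical
  refine Submodule.mul_induction_on hf (fun a ha x hx => ?_) fun x y hx hy => by simp [hx, hy]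
  rw [coeff_mul]
  refine Finset.sum_eq_zero fun p hp => ?_
  have hE := Finset.HasAntidiagonal.mem_antidiagonal.1 hp
  by_cases h : p.1 = 0
  · rw [h, coeff_zero_of_mem_irrelevantIdeal ha, zero_mul]
  · rw [coeff_eq_zero_of_mem_span_of_lt hlt hx, mul_zero]
    rw [← hE]
    exact lt_add_of_pos_left _ (pos_iff_ne_zero.2 h)

theorem irrelevantIdeal_mul_span_isHomogeneous {deg : G → ℕ}
    (hdeg : ∀ g, (gen g).IsHomogeneous (deg g)) :
    (irrelevantIdeal K n * Ideal.span (Set.range gen)).IsHomogeneous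
      (homogeneousSubmodule (Fin n × Fin n) K) := by
  refine Ideal.IsHomogeneous.mul (Ideal.homogeneous_span _ _ ?_) (Ideal.homogeneous_span _ _ ?_)
  · rintro _ ⟨s, rfl⟩
    exact ⟨1, isHomogeneous_X K s⟩
  · rintro _ ⟨g, rfl⟩
    exact ⟨deg g, hdeg g⟩

theorem gradedPiece_span_eq_sup [Fintype G] {deg : G → ℕ}
    (hdeg : ∀ g, (gen g).IsHomogeneous (deg g)) (j : ℕ) :
    gradedPiece K n (Ideal.span (Set.range gen)) j =
      Submodule.span K (Set.range fun g : {g // deg g = j} => gen g) ⊔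
        gradedPiece K n (irrelevantIdeal K n * Ideal.span (Set.range gen)) j := by
  classical
  apply le_antisymm
  · rintro f ⟨hfI, hfj⟩
    have hfI : f ∈ Ideal.span (Set.range gen) := hfI
    have hfj : f.IsHomogeneous j := hfj
    obtain ⟨a, rfl⟩ := Ideal.mem_span_range_iff_exists_fun.1 hfI
    set r := ∑ g, (a g - C (coeff 0 (a g))) * gen g with hr
    have hrm : r ∈ irrelevantIdeal K n * Ideal.span (Set.range gen) :=
      sum_mem fun g _ => Ideal.mul_mem_mul (sub_C_coeff_zero_mem_irrelevantIdeal _)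
        (Ideal.subset_span ⟨g, rfl⟩)
    have hsum : ∑ g, a g * gen g = ∑ g, C (coeff 0 (a g)) * gen g + r := by
      rw [hr, ← Finset.sum_add_distrib]
      exact Finset.sum_congr rfl fun g _ => by ring
    rw [← homogeneousComponent_eq_self hfj, hsum, map_add]
    refine add_mem (Submodule.mem_sup_left ?_) (Submodule.mem_sup_right
      ⟨homogeneousComponent_mem_of_mem (irrelevantIdeal_mul_span_isHomogeneous hdeg) hrm j,
        homogeneousComponent_mem _ _⟩)
    rw [map_sum]
    refine sum_mem fun g _ => ?_
    rw [homogeneousComponent_C_mul, homogeneousComponent_of_mem (hdeg g)]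
    split_ifs with h
    · rw [← smul_eq_C_mul]
      exact Submodule.smul_mem _ _ (Submodule.subset_span ⟨⟨g, h.symm⟩, rfl⟩)
    · simp
  · refine sup_le (Submodule.span_le.2 ?_) (inf_le_inf_right _
      (Submodule.restrictScalars_mono K Ideal.mul_le_right))
    rintro _ ⟨⟨g, rfl⟩, rfl⟩
    exact ⟨Ideal.subset_span ⟨g, rfl⟩, hdeg g⟩

/-- If homogeneous generators of an ideal are separated by the coefficients of "leading" monomials
no proper divisor of which occurs in any generator, then the number of minimal generators in
each degree is the number of given generators in that degree. -/
theorem finrank_gradedPiece_span_sub [Fintype G] [DecidableEq G] {deg : G → ℕ}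
    (hdeg : ∀ g, (gen g).IsHomogeneous (deg g)) {lead : G → (Fin n × Fin n) →₀ ℕ}
    (hlead : ∀ g g', deg g = deg g' → coeff (lead g) (gen g') = if g = g' then 1 else 0)
    (hlt : ∀ g g', ∀ e < lead g, coeff e (gen g') = 0) (j : ℕ) :
    Module.finrank K (gradedPiece K n (Ideal.span (Set.range gen)) j) -
      Module.finrank K
        (gradedPiece K n (irrelevantIdeal K n * Ideal.span (Set.range gen)) j) =
      Fintype.card {g // deg g = j} := by
  have : Module.Finite K (homogeneousSubmodule (Fin n × Fin n) K j) :=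
    Module.Finite.iff_fg.2 (homogeneousSubmodule_fg _ _ _)
  have hfin (J : Ideal (MatCoordRing K n)) : Module.Finite K (gradedPiece K n J j) :=
    Submodule.finiteDimensional_inf_right _ _
  have hcoeff (c : {g // deg g = j} → K) (g : {g // deg g = j}) :
      coeff (lead g) (∑ g', c g' • gen g') = c g := by
    have (g' : {g // deg g = j}) :
        coeff (lead g) (gen g') = if g = g' then (1 : K) else 0 := by
      rw [hlead _ _ (g.2.trans g'.2.symm)]
      simp [Subtype.ext_iff]
    simp [coeff_sum, this]
  have hli : LinearIndependent K fun g : {g // deg g = j} => gen g := by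
    rw [Fintype.linearIndependent_iff]
    intro c hc g
    rw [← hcoeff c g, hc, coeff_zero]
  have hdisj : Submodule.span K (Set.range fun g : {g // deg g = j} => gen g) ⊓
      gradedPiece K n (irrelevantIdeal K n * Ideal.span (Set.range gen)) j = ⊥ := by
    rw [eq_bot_iff]
    rintro f ⟨hf, hf', -⟩
    obtain ⟨c, rfl⟩ := (Submodule.mem_span_range_iff_exists_fun K).1 hf
    have hc : c = 0 := by
      ext g
      rw [← hcoeff c g]
      exact coeff_eq_zero_of_mem_irrelevantIdeal_mul (hlt g) hf'
    simp [hc]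
  have hspan := finrank_span_eq_card hli
  have : FiniteDimensional K
      (Submodule.span K (Set.range fun g : {g // deg g = j} => gen g)) :=
    FiniteDimensional.span_of_finite K (Set.finite_range _)
  have hadd := Submodule.finrank_sup_add_finrank_inf_eq
    (Submodule.span K (Set.range fun g : {g // deg g = j} => gen g))
    (gradedPiece K n (irrelevantIdeal K n * Ideal.span (Set.range gen)) j)
  rw [hdisj, finrank_bot, ← gradedPiece_span_eq_sup hdeg, hspan] at hadd
  omega

end GeneratorCount

section Generators

open MvPolynomial

/-- The position in row `i` and column `k` of the lower-left block `γ`. -/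
def gammaPos {m : ℕ} (i : Fin m) (k : Fin 2) : Fin (m + 2) × Fin (m + 2) :=
  (i.succ.succ, k.castLE (Nat.le_add_left 2 m))

/-- The position in row `k` and column `l` of the upper-left block `α`. -/
def alphaPos (m : ℕ) (k l : Fin 2) : Fin (m + 2) × Fin (m + 2) :=
  (k.castLE (Nat.le_add_left 2 m), l.castLE (Nat.le_add_left 2 m))

@[simp]
theorem gammaPos_inj {m : ℕ} {i j : Fin m} {k l : Fin 2} :
    gammaPos i k = gammaPos j l ↔ i = j ∧ k = l := by
  simp [gammaPos]

@[simp]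
theorem gammaPos_ne_alphaPos {m : ℕ} (i : Fin m) (k k' l : Fin 2) :
    gammaPos i k ≠ alphaPos m k' l := by
  fin_cases k' <;> simp [gammaPos, alphaPos, Fin.ext_iff]

@[simp]
theorem alphaPos_ne_gammaPos {m : ℕ} (i : Fin m) (k k' l : Fin 2) :
    alphaPos m k' l ≠ gammaPos i k :=
  (gammaPos_ne_alphaPos i k k' l).symm

@[simp]
theorem alphaPos_inj {m : ℕ} {k l k' l' : Fin 2} :
    alphaPos m k l = alphaPos m k' l' ↔ k = k' ∧ l = l' := by
  simp [alphaPos]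

variable (K : Type*) [Field K] {m : ℕ}

/-- The `2 × 2` minor of `γ` on rows `i` and `j`. -/
noncomputable def gammaMinor (i j : Fin m) : MatCoordRing K (m + 2) :=
  X (gammaPos i 0) * X (gammaPos j 1) - X (gammaPos j 0) * X (gammaPos i 1)

/-- The `2 × 2` minor on row `i` of `γ` and row `j` of `γα`. -/
noncomputable def mixedMinor (i j : Fin m) : MatCoordRing K (m + 2) :=
  X (alphaPos m 0 1) * X (gammaPos i 0) * X (gammaPos j 0)
    + X (alphaPos m 1 1) * X (gammaPos i 0) * X (gammaPos j 1)
    - X (alphaPos m 0 0) * X (gammaPos i 1) * X (gammaPos j 0)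
    - X (alphaPos m 1 0) * X (gammaPos i 1) * X (gammaPos j 1)

/-- The index set of the minimal generators of the Kalman ideal. -/
abbrev KalmanGenIndex (m : ℕ) :=
  {p : Fin m × Fin m // p.1 < p.2} ⊕ {p : Fin m × Fin m // p.1 ≤ p.2}

/-- The minimal generators of the Kalman ideal. -/
noncomputable def kalmanGen : KalmanGenIndex m → MatCoordRing K (m + 2) :=
  Sum.elim (fun p => gammaMinor K p.1.1 p.1.2) (fun p => mixedMinor K p.1.1 p.1.2)

/-- The degrees of the minimal generators. -/
def kalmanGenDeg : KalmanGenIndex m → ℕ :=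
  Sum.elim (fun _ => 2) (fun _ => 3)

/-- Monomials separating the minimal generators. -/
noncomputable def kalmanGenLead :
    KalmanGenIndex m → (Fin (m + 2) × Fin (m + 2)) →₀ ℕ :=
  Sum.elim
    (fun p => Finsupp.single (gammaPos p.1.1 0) 1 + Finsupp.single (gammaPos p.1.2 1) 1)
    (fun p => Finsupp.single (alphaPos m 0 1) 1 +
      (Finsupp.single (gammaPos p.1.1 0) 1 + Finsupp.single (gammaPos p.1.2 0) 1))

theorem kalmanGen_isHomogeneous (g : KalmanGenIndex m) :
    (kalmanGen K g).IsHomogeneous (kalmanGenDeg g) := by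
  have hX (s : Fin (m + 2) × Fin (m + 2)) : (X s : MatCoordRing K (m + 2)).IsHomogeneous 1 :=
    isHomogeneous_X K s
  rcases g with p | p
  · exact ((hX _).mul (hX _)).sub ((hX _).mul (hX _))
  · exact (((((hX _).mul (hX _)).mul (hX _)).add (((hX _).mul (hX _)).mul (hX _))).sub
      (((hX _).mul (hX _)).mul (hX _))).sub (((hX _).mul (hX _)).mul (hX _))

theorem degree_kalmanGenLead (g : KalmanGenIndex m) :
    (kalmanGenLead g).degree = kalmanGenDeg g := by
  rcases g with p | p <;> simp [kalmanGenLead, kalmanGenDeg]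

theorem coeff_X_mul_X {σ : Type*} [DecidableEq σ] (s t : σ) (e : σ →₀ ℕ) :
    coeff e (X s * X t : MvPolynomial σ K) =
      if Finsupp.single s 1 + Finsupp.single t 1 = e then 1 else 0 := by
  classical
  rw [X, X, monomial_mul, coeff_monomial, one_mul]

theorem coeff_X_mul_X_mul_X {σ : Type*} [DecidableEq σ] (r s t : σ) (e : σ →₀ ℕ) :
    coeff e (X r * X s * X t : MvPolynomial σ K) =
      if Finsupp.single r 1 + (Finsupp.single s 1 + Finsupp.single t 1) = e then 1 else 0 := by
  rw [X, X, X, monomial_mul, monomial_mul, coeff_monomial, one_mul, one_mul, add_assoc]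

theorem coeff_kalmanGenLead (g g' : KalmanGenIndex m) (h : kalmanGenDeg g = kalmanGenDeg g') :
    coeff (kalmanGenLead g) (kalmanGen K g') = if g = g' then 1 else 0 := by
  rcases g with ⟨⟨i, j⟩, hij⟩ | ⟨⟨i, j⟩, hij⟩ <;> rcases g' with ⟨⟨k, l⟩, hkl⟩ | ⟨⟨k, l⟩, hkl⟩
  · simp only [kalmanGenLead, kalmanGen, gammaMinor, Sum.elim_inl, coeff_sub, coeff_X_mul_X]
    dsimp only at hij hkl
    simp only [Finsupp.single_add_single_eq_single_add_single one_ne_zero one_ne_zero]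
    simp
    grind
  · simp [kalmanGenDeg] at h
  · simp [kalmanGenDeg] at h
  · simp only [kalmanGenLead, kalmanGen, mixedMinor, Sum.elim_inr, coeff_sub, coeff_add,
      coeff_X_mul_X_mul_X]
    dsimp only at hij hkl
    have hne (s t : Fin (m + 2) × Fin (m + 2)) (a : Fin m) :
        Finsupp.single s 1 + (Finsupp.single t 1 + Finsupp.single (gammaPos a 1) 1) ≠
          Finsupp.single (alphaPos m 0 1) 1 +
            (Finsupp.single (gammaPos i 0) 1 + Finsupp.single (gammaPos j 0) 1) := by
      intro heq
      simpa [Finsupp.single_apply] using DFunLike.congr_fun heq (gammaPos a 1)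
    rw [if_neg (hne _ _ _), if_neg (hne _ _ _),
      add_comm (Finsupp.single (gammaPos k 1) 1), if_neg (hne _ _ _)]
    simp only [add_right_inj,
      Finsupp.single_add_single_eq_single_add_single one_ne_zero one_ne_zero]
    simp
    grind

theorem coeff_kalmanGen_of_lt_kalmanGenLead (g g' : KalmanGenIndex m)
    (e : (Fin (m + 2) × Fin (m + 2)) →₀ ℕ) (he : e < kalmanGenLead g) :
    coeff e (kalmanGen K g') = 0 := by
  have hdeg : e.degree < kalmanGenDeg g := by
    obtain ⟨d, hd⟩ := le_iff_exists_add.1 he.le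
    have hd0 : d ≠ 0 := by
      rintro rfl
      exact he.ne (by rw [hd, add_zero])
    rw [← degree_kalmanGenLead, hd, map_add]
    have := (Finsupp.degree_eq_zero_iff d).not.2 hd0
    omega
  by_cases h : e.degree = kalmanGenDeg g'
  · rcases g with ⟨⟨i, j⟩, hij⟩ | ⟨⟨i, j⟩, hij⟩ <;> rcases g' with ⟨⟨k, l⟩, hkl⟩ | ⟨⟨k, l⟩, hkl⟩
    · simp [kalmanGenDeg] at h hdeg
      omega
    · simp [kalmanGenDeg] at h hdeg
      omega
    · have hne (t : Fin (m + 2) × Fin (m + 2)) (a : Fin m) :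
          Finsupp.single t 1 + Finsupp.single (gammaPos a 1) 1 ≠ e := by
        rintro rfl
        simpa [kalmanGenLead, Finsupp.single_apply] using he.le (gammaPos a 1)
      simp only [kalmanGen, gammaMinor, Sum.elim_inl, coeff_sub, coeff_X_mul_X]
      rw [if_neg (hne _ _), if_neg (hne _ _), sub_zero]
    · simp [kalmanGenDeg] at h hdeg
      omega
  · exact (kalmanGen_isHomogeneous K g').coeff_eq_zero h

end Generators

section VanishingOfGenerators

open MvPolynomial

variable (K : Type*) [Field K] {m : ℕ}

theorem gammaMinor_mem_span_kalmanGen (i j : Fin m) :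
    gammaMinor K i j ∈ Ideal.span (Set.range (kalmanGen K (m := m))) := by
  rcases lt_trichotomy i j with h | rfl | h
  · exact Ideal.subset_span ⟨Sum.inl ⟨(i, j), h⟩, rfl⟩
  · simp [gammaMinor]
  · have hji : gammaMinor K i j = -gammaMinor K j i := by
      simp only [gammaMinor]
      ring
    rw [hji]
    exact neg_mem (Ideal.subset_span ⟨Sum.inl ⟨(j, i), h⟩, rfl⟩)

theorem mixedMinor_mem_span_kalmanGen (i j : Fin m) :
    mixedMinor K i j ∈ Ideal.span (Set.range (kalmanGen K (m := m))) := by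
  rcases le_total i j with h | h
  · exact Ideal.subset_span ⟨Sum.inr ⟨(i, j), h⟩, rfl⟩
  · have hji : mixedMinor K i j = mixedMinor K j i +
        (X (alphaPos m 0 0) + X (alphaPos m 1 1)) * gammaMinor K i j := by
      simp only [mixedMinor, gammaMinor]
      ring
    rw [hji]
    exact add_mem (Ideal.subset_span ⟨Sum.inr ⟨(j, i), h⟩, rfl⟩)
      (Ideal.mul_mem_left _ _ (gammaMinor_mem_span_kalmanGen K i j))

variable {K}

theorem mul_sub_mul_eq_zero_of_common_kernel {p q r s x y : K} (hxy : x ≠ 0 ∨ y ≠ 0)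
    (h₁ : p * x + q * y = 0) (h₂ : r * x + s * y = 0) : p * s - q * r = 0 := by
  rcases hxy with h | h
  · exact (mul_eq_zero.1 (show x * (p * s - q * r) = 0 by linear_combination s * h₁ - q * h₂))
      |>.resolve_left h
  · exact (mul_eq_zero.1 (show y * (p * s - q * r) = 0 by linear_combination p * h₂ - r * h₁))
      |>.resolve_left h

theorem exists_eigenvector_of_mem_kalmanSet {M : Matrix (Fin (m + 2)) (Fin (m + 2)) K}
    (hM : M ∈ kalmanSet K (m + 2) 2 1) :
    ∃ x y c : K, (x ≠ 0 ∨ y ≠ 0) ∧ M 0 0 * x + M 0 1 * y = c * x ∧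
      M 1 0 * x + M 1 1 * y = c * y ∧
      ∀ i : Fin m, M i.succ.succ 0 * x + M i.succ.succ 1 * y = 0 := by
  obtain ⟨U, hUL, hU, hMU⟩ := hM
  obtain ⟨⟨v, hvU⟩, hv0, hv⟩ := finrank_eq_one_iff'.1 hU
  obtain ⟨c, hc⟩ := hv ⟨_, hMU v hvU⟩
  have hc : c • v = M.mulVec v := congrArg Subtype.val hc
  have hz (i : Fin m) : v i.succ.succ = 0 := hUL hvU _ (by simp)
  have hrow (i : Fin (m + 2)) : M i 0 * v 0 + M i 1 * v 1 = c * v i := by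
    have := congrFun hc i
    simp only [Matrix.mulVec, dotProduct, Fin.sum_univ_succ, hz, mul_zero, Finset.sum_const_zero,
      add_zero, Pi.smul_apply, smul_eq_mul] at this
    exact this.symm
  refine ⟨v 0, v 1, c, ?_, hrow 0, hrow 1, fun i => by rw [hrow, hz, mul_zero]⟩
  by_contra! h
  refine hv0 (Subtype.ext (funext fun i => ?_))
  refine Fin.cases h.1 (fun i => Fin.cases h.2 hz i) i

theorem span_kalmanGen_le_kalmanIdeal :
    Ideal.span (Set.range (kalmanGen K (m := m))) ≤ kalmanIdeal K (m + 2) 2 1 := by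
  rw [Ideal.span_le]
  rintro _ ⟨g, rfl⟩ M hM
  obtain ⟨x, y, c, hxy, h0, h1, h⟩ := exists_eigenvector_of_mem_kalmanSet hM
  have ha : eval (fun p => M p.1 p.2) (X (alphaPos m 0 0)) = M 0 0 := eval_X _
  have hb : eval (fun p => M p.1 p.2) (X (alphaPos m 0 1)) = M 0 1 := eval_X _
  have hc : eval (fun p => M p.1 p.2) (X (alphaPos m 1 0)) = M 1 0 := eval_X _
  have hd : eval (fun p => M p.1 p.2) (X (alphaPos m 1 1)) = M 1 1 := eval_X _
  have hu (i : Fin m) : eval (fun p => M p.1 p.2) (X (gammaPos i 0)) = M i.succ.succ 0 := eval_X _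
  have hv (i : Fin m) : eval (fun p => M p.1 p.2) (X (gammaPos i 1)) = M i.succ.succ 1 := eval_X _
  rcases g with ⟨⟨i, j⟩, -⟩ | ⟨⟨i, j⟩, -⟩
  · simp only [kalmanGen, gammaMinor, Sum.elim_inl, map_sub, map_mul, hu, hv]
    linear_combination mul_sub_mul_eq_zero_of_common_kernel hxy (h i) (h j)
  · simp only [kalmanGen, mixedMinor, Sum.elim_inr, map_sub, map_add, map_mul, ha, hb, hc, hd,
      hu, hv]
    have hj : (M j.succ.succ 0 * M 0 0 + M j.succ.succ 1 * M 1 0) * x +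
        (M j.succ.succ 0 * M 0 1 + M j.succ.succ 1 * M 1 1) * y = 0 := by
      linear_combination M j.succ.succ 0 * h0 + M j.succ.succ 1 * h1 + c * h j
    linear_combination mul_sub_mul_eq_zero_of_common_kernel hxy (h i) hj

end VanishingOfGenerators

section ToricParametrization

open MvPolynomial

/-- The variables `t₁, …, tₘ`, `x₀, x₁` of a parametrization of matrices whose block `γ` has rank
at most one, together with a variable for every matrix entry (used outside `γ`). -/
abbrev ToricVar (m : ℕ) := Fin m ⊕ Fin 2 ⊕ (Fin (m + 2) × Fin (m + 2))

variable {m : ℕ}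

/-- The exponent of the monomial parametrizing a matrix entry: `tᵢ xₖ` for the entry `(i, k)` of
`γ`, and a free variable for an entry outside `γ`. -/
noncomputable def toricVarExp (s : Fin (m + 2) × Fin (m + 2)) : ToricVar m →₀ ℕ :=
  if h : 2 ≤ (s.1 : ℕ) ∧ (s.2 : ℕ) < 2 then
    Finsupp.single (Sum.inl ⟨s.1 - 2, by have := s.1.isLt; omega⟩) 1 +
      Finsupp.single (Sum.inr (Sum.inl ⟨s.2, h.2⟩)) 1
  else Finsupp.single (Sum.inr (Sum.inr s)) 1

theorem toricVarExp_gammaPos (i : Fin m) (k : Fin 2) :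
    toricVarExp (gammaPos i k) =
      Finsupp.single (Sum.inl i) 1 + Finsupp.single (Sum.inr (Sum.inl k)) 1 := by
  rw [toricVarExp, dif_pos ⟨by simp [gammaPos], by simp only [gammaPos, Fin.val_castLE]; omega⟩]
  simp [gammaPos]

theorem toricVarExp_alphaPos (k l : Fin 2) :
    toricVarExp (alphaPos m k l) = Finsupp.single (Sum.inr (Sum.inr (alphaPos m k l))) 1 := by
  rw [toricVarExp, dif_neg]
  simp [alphaPos]
  omega

theorem exists_gammaPos_or_toricVarExp_eq (s : Fin (m + 2) × Fin (m + 2)) :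
    (∃ i k, s = gammaPos i k) ∨ toricVarExp s = Finsupp.single (Sum.inr (Sum.inr s)) 1 := by
  by_cases h : 2 ≤ (s.1 : ℕ) ∧ (s.2 : ℕ) < 2
  · refine Or.inl ⟨⟨s.1 - 2, by have := s.1.isLt; omega⟩, ⟨s.2, h.2⟩, ?_⟩
    ext
    · simp [gammaPos]
      omega
    · simp [gammaPos]
  · exact Or.inr (dif_neg h)

/-- The map on exponents induced by the monomial parametrization. -/
noncomputable def toricExp :
    ((Fin (m + 2) × Fin (m + 2)) →₀ ℕ) →ₗ[ℕ] (ToricVar m →₀ ℕ) :=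
  Finsupp.linearCombination ℕ toricVarExp

theorem toricExp_single (s : Fin (m + 2) × Fin (m + 2)) :
    toricExp (Finsupp.single s 1) = toricVarExp s := by
  simp [toricExp]

theorem exists_eq_single_add_of_toricExp_ne_zero {e : (Fin (m + 2) × Fin (m + 2)) →₀ ℕ}
    {z : ToricVar m} (h : toricExp e z ≠ 0) :
    ∃ s e', e = Finsupp.single s 1 + e' ∧ toricVarExp s z ≠ 0 := by
  rw [toricExp, Finsupp.linearCombination_apply, Finsupp.sum, Finsupp.finsetSum_apply] at h
  obtain ⟨s, hs, hz⟩ := Finset.exists_ne_zero_of_sum_ne_zero h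
  refine ⟨s, e - Finsupp.single s 1, (add_tsub_cancel_of_le ?_).symm, fun h0 => hz (by simp [h0])⟩
  rw [Finsupp.single_le_iff]
  exact Nat.one_le_iff_ne_zero.2 (Finsupp.mem_support_iff.1 hs)

theorem exists_eq_single_add_of_toricExp_row_ne_zero {e : (Fin (m + 2) × Fin (m + 2)) →₀ ℕ}
    {i : Fin m} (h : toricExp e (Sum.inl i) ≠ 0) :
    ∃ k e', e = Finsupp.single (gammaPos i k) 1 + e' := by
  obtain ⟨s, e', rfl, hs⟩ := exists_eq_single_add_of_toricExp_ne_zero h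
  rcases exists_gammaPos_or_toricVarExp_eq s with ⟨j, k, rfl⟩ | h'
  · obtain rfl : j = i := by simpa [toricVarExp_gammaPos, Finsupp.single_apply] using hs
    exact ⟨k, e', rfl⟩
  · simp [h'] at hs

theorem exists_eq_single_add_of_toricExp_col_ne_zero {e : (Fin (m + 2) × Fin (m + 2)) →₀ ℕ}
    {k : Fin 2} (h : toricExp e (Sum.inr (Sum.inl k)) ≠ 0) :
    ∃ i e', e = Finsupp.single (gammaPos i k) 1 + e' := by
  obtain ⟨s, e', rfl, hs⟩ := exists_eq_single_add_of_toricExp_ne_zero h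
  rcases exists_gammaPos_or_toricVarExp_eq s with ⟨i, l, rfl⟩ | h'
  · obtain rfl : l = k := by simpa [toricVarExp_gammaPos, Finsupp.single_apply] using hs
    exact ⟨i, e', rfl⟩
  · simp [h'] at hs

theorem exists_eq_single_add_of_toricExp_free_ne_zero {e : (Fin (m + 2) × Fin (m + 2)) →₀ ℕ}
    {s : Fin (m + 2) × Fin (m + 2)} (h : toricExp e (Sum.inr (Sum.inr s)) ≠ 0) :
    ∃ e', e = Finsupp.single s 1 + e' := by
  obtain ⟨r, e', rfl, hr⟩ := exists_eq_single_add_of_toricExp_ne_zero h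
  rcases exists_gammaPos_or_toricVarExp_eq r with ⟨i, l, rfl⟩ | h'
  · simp [toricVarExp_gammaPos] at hr
  · obtain rfl : r = s := by simpa [h', Finsupp.single_apply] using hr
    exact ⟨e', rfl⟩

variable (K : Type*) [Field K]

theorem gammaPos_swap_mem_span_kalmanGen (i j : Fin m) (k l : Fin 2) :
    (X (gammaPos i k) * X (gammaPos j l) - X (gammaPos i l) * X (gammaPos j k) :
      MatCoordRing K (m + 2)) ∈ Ideal.span (Set.range (kalmanGen K (m := m))) := by
  have h := gammaMinor_mem_span_kalmanGen K i j
  have h' := neg_mem h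
  rw [gammaMinor] at h h'
  fin_cases k <;> fin_cases l
  · simp
  · convert h using 1
    simp
    ring
  · convert h' using 1
    simp
    ring
  · simp

theorem monomial_sub_monomial_mem_span_kalmanGen (d : ℕ) :
    ∀ e e' : (Fin (m + 2) × Fin (m + 2)) →₀ ℕ, e.degree = d → toricExp e = toricExp e' →
      (monomial e 1 - monomial e' 1 : MatCoordRing K (m + 2)) ∈
        Ideal.span (Set.range (kalmanGen K (m := m))) := by
  induction d with
  | zero =>
    intro e e' he h
    obtain rfl := (Finsupp.degree_eq_zero_iff e).1 he
    suffices e' = 0 by simp [this]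
    by_contra h0
    obtain ⟨s, hs⟩ := Finsupp.ne_iff.1 h0
    have he' : e' = Finsupp.single s 1 + (e' - Finsupp.single s 1) := by
      refine (add_tsub_cancel_of_le ?_).symm
      rw [Finsupp.single_le_iff]
      exact Nat.one_le_iff_ne_zero.2 hs
    rw [he', map_zero, map_add, toricExp_single] at h
    have h1 := (add_eq_zero.1 h.symm).1
    rcases exists_gammaPos_or_toricVarExp_eq s with ⟨i, k, rfl⟩ | h'
    · simp [toricVarExp_gammaPos] at h1
    · simp [h'] at h1
  | succ d ih =>
    have cancel (s : Fin (m + 2) × Fin (m + 2)) (e e' : (Fin (m + 2) × Fin (m + 2)) →₀ ℕ)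
        (he : (Finsupp.single s 1 + e).degree = d + 1)
        (h : toricExp (Finsupp.single s 1 + e) = toricExp (Finsupp.single s 1 + e')) :
        (monomial (Finsupp.single s 1 + e) 1 - monomial (Finsupp.single s 1 + e') 1 :
          MatCoordRing K (m + 2)) ∈ Ideal.span (Set.range (kalmanGen K (m := m))) := by
      rw [monomial_single_add, monomial_single_add, ← mul_sub]
      refine Ideal.mul_mem_left _ _ (ih e e' ?_ ?_)
      · rw [map_add, Finsupp.degree_single] at he
        omega
      · rwa [map_add, map_add, add_right_inj] at h
    intro e e' he h
    have h0 : e ≠ 0 := by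
      rintro rfl
      simp at he
    obtain ⟨s, hs⟩ := Finsupp.ne_iff.1 h0
    obtain ⟨e, rfl⟩ : ∃ e₁, e = Finsupp.single s 1 + e₁ := by
      refine le_iff_exists_add.1 ?_
      rw [Finsupp.single_le_iff]
      exact Nat.one_le_iff_ne_zero.2 hs
    rcases exists_gammaPos_or_toricVarExp_eq s with ⟨i, k, rfl⟩ | h'
    · obtain ⟨l, e₁, rfl⟩ := exists_eq_single_add_of_toricExp_row_ne_zero (e := e') (i := i) (by
        rw [← h, map_add, toricExp_single, toricVarExp_gammaPos]
        simp)
      by_cases hl : l = k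
      · subst hl
        exact cancel _ _ _ he h
      obtain ⟨j, e₂, rfl⟩ := exists_eq_single_add_of_toricExp_col_ne_zero (e := e₁) (k := k) (by
        have := DFunLike.congr_fun h (Sum.inr (Sum.inl k))
        simp [toricExp_single, toricVarExp_gammaPos, hl] at this
        omega)
      have hswap := cancel (gammaPos i k) e (Finsupp.single (gammaPos j l) 1 + e₂) he (by
        rw [h]
        simp only [map_add, toricExp_single, toricVarExp_gammaPos]
        abel)
      have := add_mem hswap (Ideal.mul_mem_right (monomial e₂ 1) _
        (gammaPos_swap_mem_span_kalmanGen K i j k l))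
      convert this using 1
      simp only [monomial_single_add, pow_one]
      ring
    · obtain ⟨e₁, rfl⟩ := exists_eq_single_add_of_toricExp_free_ne_zero (e := e') (s := s) (by
        rw [← h, map_add, toricExp_single, h']
        simp)
      exact cancel _ _ _ he h

end ToricParametrization

section Saturation

open MvPolynomial

variable (K : Type*) [Field K] {m : ℕ}

/-- The monomial parametrization of matrices whose block `γ` has rank at most one. -/
noncomputable def toricHom : MatCoordRing K (m + 2) →ₐ[K] MvPolynomial (ToricVar m) K :=
  aeval fun s => monomial (toricVarExp s) 1

theorem toricHom_monomial (e : (Fin (m + 2) × Fin (m + 2)) →₀ ℕ) :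
    toricHom K (monomial e 1) = monomial (toricExp e) 1 := by
  induction e using Finsupp.induction_linear with
  | zero => simp
  | add e e' h h' =>
    rw [← one_mul (1 : K), ← monomial_mul, map_mul, h, h', monomial_mul, one_mul, map_add]
  | single s k =>
    rw [← X_pow_eq_monomial, map_pow, toricHom, aeval_X, monomial_pow, one_pow, toricExp,
      Finsupp.linearCombination_single]

open Classical in
/-- A linear section of the monomial parametrization modulo the ideal generated by the minors,
which kills the monomials outside the image. -/
noncomputable def toricSection :
    MvPolynomial (ToricVar m) K →ₗ[K]
      MatCoordRing K (m + 2) ⧸ Ideal.span (Set.range (kalmanGen K (m := m))) :=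
  (basisMonomials (ToricVar m) K).constr K fun E =>
    if h : ∃ e, toricExp e = E then Ideal.Quotient.mk _ (monomial h.choose 1) else 0

theorem toricSection_monomial_of_not_exists {E : ToricVar m →₀ ℕ}
    (h : ¬ ∃ e, toricExp e = E) : toricSection K (monomial E 1) = 0 := by
  classical
  have hE : (monomial E 1 : MvPolynomial (ToricVar m) K) = basisMonomials (ToricVar m) K E := by
    rw [coe_basisMonomials]
  rw [toricSection, hE, Module.Basis.constr_basis, dif_neg h]

theorem toricSection_monomial_toricExp (e : (Fin (m + 2) × Fin (m + 2)) →₀ ℕ) :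
    toricSection K (monomial (toricExp e) 1) = Ideal.Quotient.mk _ (monomial e 1) := by
  classical
  have h : ∃ e', toricExp e' = toricExp e := ⟨e, rfl⟩
  have hE : (monomial (toricExp e) 1 : MvPolynomial (ToricVar m) K) =
      basisMonomials (ToricVar m) K (toricExp e) := by
    rw [coe_basisMonomials]
  rw [toricSection, hE, Module.Basis.constr_basis, dif_pos h,
    Ideal.Quotient.eq]
  exact monomial_sub_monomial_mem_span_kalmanGen K _ _ _ rfl h.choose_spec

theorem toricSection_toricHom (f : MatCoordRing K (m + 2)) :
    toricSection K (toricHom K f) = Ideal.Quotient.mk _ f := by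
  induction f using MvPolynomial.induction_on' with
  | monomial e a =>
    have h : (monomial e a : MatCoordRing K (m + 2)) = a • monomial e 1 := by
      simp [smul_monomial]
    rw [h, map_smul, map_smul, toricHom_monomial, toricSection_monomial_toricExp,
      ← Ideal.Quotient.mkₐ_eq_mk K, map_smul]
  | add p q hp hq => rw [map_add, map_add, hp, hq, map_add]

/-- The variable of the parametrization for the entry `(k, l)` of the block `α`. -/
abbrev alphaVar (m : ℕ) (k l : Fin 2) : ToricVar m := Sum.inr (Sum.inr (alphaPos m k l))

/-- The variable `xₖ` of the parametrization. -/
abbrev colVar (m : ℕ) (k : Fin 2) : ToricVar m := Sum.inr (Sum.inl k)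

/-- The quadratic form expressing that `(x₀, x₁)` is a left eigenvector of `α`. -/
noncomputable def eigenForm (m : ℕ) : MvPolynomial (ToricVar m) K :=
  X (alphaVar m 0 1) * X (colVar m 0) * X (colVar m 0)
    + X (alphaVar m 1 1) * X (colVar m 0) * X (colVar m 1)
    - X (alphaVar m 0 0) * X (colVar m 1) * X (colVar m 0)
    - X (alphaVar m 1 0) * X (colVar m 1) * X (colVar m 1)

theorem toricHom_X_gammaPos (i : Fin m) (k : Fin 2) :
    toricHom K (X (gammaPos i k)) = X (Sum.inl i) * X (colVar m k) := by
  rw [toricHom, aeval_X, toricVarExp_gammaPos, X, X, monomial_mul, one_mul]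

theorem toricHom_X_alphaPos (k l : Fin 2) :
    toricHom K (X (alphaPos m k l)) = X (alphaVar m k l) := by
  rw [toricHom, aeval_X, toricVarExp_alphaPos, X]

theorem toricHom_mixedMinor (i j : Fin m) :
    toricHom K (mixedMinor K i j) = X (Sum.inl i) * X (Sum.inl j) * eigenForm K m := by
  simp only [mixedMinor, eigenForm, map_add, map_sub, map_mul, toricHom_X_alphaPos,
    toricHom_X_gammaPos]
  ring

variable {K} in
theorem exists_eq_of_toricExp_eq {e : (Fin (m + 2) × Fin (m + 2)) →₀ ℕ}
    {E : ToricVar m →₀ ℕ} {k l k' l' : Fin 2}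
    (h : toricExp e = Finsupp.single (alphaVar m k l) 1 +
      (Finsupp.single (colVar m k') 1 + (Finsupp.single (colVar m l') 1 + E))) :
    ∃ i j e', E = Finsupp.single (Sum.inl i) 1 + (Finsupp.single (Sum.inl j) 1 + toricExp e') := by
  obtain ⟨e, rfl⟩ := exists_eq_single_add_of_toricExp_free_ne_zero (e := e)
    (s := alphaPos m k l) (by simp [h])
  rw [map_add, toricExp_single, toricVarExp_alphaPos, add_right_inj] at h
  obtain ⟨i, e, rfl⟩ := exists_eq_single_add_of_toricExp_col_ne_zero (e := e)
    (k := k') (by simp [h])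
  rw [map_add, toricExp_single, toricVarExp_gammaPos, add_comm (Finsupp.single (Sum.inl i) 1),
    add_assoc, add_right_inj] at h
  obtain ⟨j, e, rfl⟩ : ∃ j e', e = Finsupp.single (gammaPos j l') 1 + e' := by
    refine exists_eq_single_add_of_toricExp_col_ne_zero ?_
    have := DFunLike.congr_fun h (Sum.inr (Sum.inl l'))
    simp at this
    omega
  refine ⟨i, j, e, ?_⟩
  rw [map_add, toricExp_single, toricVarExp_gammaPos] at h
  refine add_left_cancel (a := Finsupp.single (colVar m l') 1) ?_
  rw [← h]
  abel

theorem toricSection_eigenForm_mul (g : MvPolynomial (ToricVar m) K) :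
    toricSection K (eigenForm K m * g) = 0 := by
  induction g using MvPolynomial.induction_on' with
  | add p q hp hq => rw [mul_add, map_add, hp, hq, add_zero]
  | monomial E a =>
    have ha : (monomial E a : MvPolynomial (ToricVar m) K) = a • monomial E 1 := by
      simp [smul_monomial]
    rw [ha, mul_smul_comm, map_smul]
    suffices toricSection K (eigenForm K m * monomial E 1) = 0 by rw [this, smul_zero]
    by_cases h : ∃ i j e', E = Finsupp.single (Sum.inl i) 1 +
        (Finsupp.single (Sum.inl j) 1 + toricExp e')
    · obtain ⟨i, j, e', rfl⟩ := h
      have hE : eigenForm K m * monomial (Finsupp.single (Sum.inl i) 1 +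
          (Finsupp.single (Sum.inl j) 1 + toricExp e')) 1 =
          toricHom K (mixedMinor K i j * monomial e' 1) := by
        rw [map_mul, toricHom_mixedMinor, toricHom_monomial, monomial_single_add,
          monomial_single_add]
        ring
      rw [hE, toricSection_toricHom, Ideal.Quotient.eq_zero_iff_mem]
      exact Ideal.mul_mem_right _ _ (mixedMinor_mem_span_kalmanGen K i j)
    · have hterm (k l k' l' : Fin 2) : toricSection K (X (alphaVar m k l) * X (colVar m k') *
          X (colVar m l') * monomial E 1) = 0 := by
        have hE : (X (alphaVar m k l) * X (colVar m k') * X (colVar m l') * monomial E 1 :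
            MvPolynomial (ToricVar m) K) = monomial (Finsupp.single (alphaVar m k l) 1 +
              (Finsupp.single (colVar m k') 1 + (Finsupp.single (colVar m l') 1 + E))) 1 := by
          simp only [monomial_single_add, pow_one]
          ring
        rw [hE]
        exact toricSection_monomial_of_not_exists K fun ⟨e, he⟩ => h (exists_eq_of_toricExp_eq he)
      rw [eigenForm, sub_mul, sub_mul, add_mul, map_sub, map_sub, map_add]
      simp only [hterm, add_zero, sub_zero]

/-- Setting the variable of the lower left entry of `α` to zero. -/
noncomputable def eraseLowerLeft (m : ℕ) :
    MvPolynomial (ToricVar m) K →ₐ[K] MvPolynomial (ToricVar m) K :=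
  aeval fun z => if z = alphaVar m 1 0 then 0 else X z

variable {K} in
theorem eraseLowerLeft_X {z : ToricVar m} (hz : z ≠ alphaVar m 1 0) :
    eraseLowerLeft K m (X z) = X z := by
  rw [eraseLowerLeft, aeval_X, if_neg hz]

variable {K} in
theorem exists_pow_mul_eq_add_eigenForm_mul (F : MvPolynomial (ToricVar m) K) :
    ∃ (N : ℕ) (G H : MvPolynomial (ToricVar m) K),
      X (colVar m 1) ^ N * F = G + eigenForm K m * H ∧ eraseLowerLeft K m G = G := by
  have hy : eraseLowerLeft K m (X (colVar m 1)) = X (colVar m 1) := eraseLowerLeft_X (by simp)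
  induction F using MvPolynomial.induction_on with
  | C a => exact ⟨0, C a, 0, by simp, by simp [eraseLowerLeft]⟩
  | add F F' hF hF' =>
    obtain ⟨N, G, H, h, hG⟩ := hF
    obtain ⟨N', G', H', h', hG'⟩ := hF'
    refine ⟨N + N', X (colVar m 1) ^ N' * G + X (colVar m 1) ^ N * G',
      X (colVar m 1) ^ N' * H + X (colVar m 1) ^ N * H', ?_, ?_⟩
    · linear_combination X (colVar m 1) ^ N' * h + X (colVar m 1) ^ N * h'
    · simp only [map_add, map_mul, map_pow, hy, hG, hG']
  | mul_X F z hF =>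
    obtain ⟨N, G, H, h, hG⟩ := hF
    by_cases hz : z = alphaVar m 1 0
    · subst hz
      refine ⟨N + 2, G * (X (alphaVar m 0 1) * X (colVar m 0) * X (colVar m 0)
          + X (alphaVar m 1 1) * X (colVar m 0) * X (colVar m 1)
          - X (alphaVar m 0 0) * X (colVar m 1) * X (colVar m 0)),
        H * X (colVar m 1) ^ 2 * X (alphaVar m 1 0) - G, ?_, ?_⟩
      · rw [eigenForm] at h ⊢
        linear_combination X (colVar m 1) ^ 2 * X (alphaVar m 1 0) * h
      · have h01 : eraseLowerLeft K m (X (alphaVar m 0 1)) = X (alphaVar m 0 1) :=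
          eraseLowerLeft_X (by simp)
        have h11 : eraseLowerLeft K m (X (alphaVar m 1 1)) = X (alphaVar m 1 1) :=
          eraseLowerLeft_X (by simp)
        have h00 : eraseLowerLeft K m (X (alphaVar m 0 0)) = X (alphaVar m 0 0) :=
          eraseLowerLeft_X (by simp)
        have hx : eraseLowerLeft K m (X (colVar m 0)) = X (colVar m 0) :=
          eraseLowerLeft_X (by simp)
        simp only [map_sub, map_add, map_mul, hy, hG, h01, h11, h00, hx]
    · refine ⟨N, G * X z, H * X z, ?_, by rw [map_mul, hG, eraseLowerLeft_X hz]⟩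
      linear_combination X z * h

variable {K}

theorem toricPoint_mem_kalmanSet (p : ToricVar m → K) (hy : p (colVar m 1) ≠ 0)
    (hp : eval p (eigenForm K m) = 0) :
    (fun r l => eval p (monomial (toricVarExp (r, l)) 1) :
      Matrix (Fin (m + 2)) (Fin (m + 2)) K) ∈ kalmanSet K (m + 2) 2 1 := by
  set M : Matrix (Fin (m + 2)) (Fin (m + 2)) K :=
    fun r l => eval p (monomial (toricVarExp (r, l)) 1) with hM
  have hα (k l : Fin 2) : M (k.castLE (Nat.le_add_left 2 m)) (l.castLE (Nat.le_add_left 2 m)) =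
      p (alphaVar m k l) := by
    change eval p (monomial (toricVarExp (alphaPos m k l)) 1) = _
    rw [toricVarExp_alphaPos]
    exact eval_X _
  have hγ (i : Fin m) (k : Fin 2) : M i.succ.succ (k.castLE (Nat.le_add_left 2 m)) =
      p (Sum.inl i) * p (colVar m k) := by
    change eval p (monomial (toricVarExp (gammaPos i k)) 1) = _
    have h : (monomial (toricVarExp (gammaPos i k)) 1 : MvPolynomial (ToricVar m) K) =
        X (Sum.inl i) * X (colVar m k) := by
      rw [toricVarExp_gammaPos, X, X, monomial_mul, one_mul]
    rw [h, map_mul, eval_X, eval_X]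
  have h00 : M 0 0 = p (alphaVar m 0 0) := hα 0 0
  have h01 : M 0 1 = p (alphaVar m 0 1) := hα 0 1
  have h10 : M 1 0 = p (alphaVar m 1 0) := hα 1 0
  have h11 : M 1 1 = p (alphaVar m 1 1) := hα 1 1
  have hu (i : Fin m) : M i.succ.succ 0 = p (Sum.inl i) * p (colVar m 0) := hγ i 0
  have hv (i : Fin m) : M i.succ.succ 1 = p (Sum.inl i) * p (colVar m 1) := hγ i 1
  set x := p (colVar m 0)
  set y := p (colVar m 1)
  set v : Fin (m + 2) → K := Fin.cons y (Fin.cons (-x) 0) with hvdef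
  have hv0 : v 0 = y := rfl
  have hv1 : v 1 = -x := rfl
  have hvz (i : Fin m) : v i.succ.succ = 0 := rfl
  have hMv : M.mulVec v = ((p (alphaVar m 0 0) * y - p (alphaVar m 0 1) * x) / y) • v := by
    have hrow (r : Fin (m + 2)) : M.mulVec v r = M r 0 * y - M r 1 * x := by
      simp only [Matrix.mulVec, dotProduct, Fin.sum_univ_succ, hvz, mul_zero,
        Finset.sum_const_zero, add_zero]
      rw [hv0, show v (Fin.succ 0) = -x from rfl, Fin.succ_zero_eq_one]
      ring
    ext r
    rw [hrow, Pi.smul_apply, smul_eq_mul]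
    refine Fin.cases ?_ (fun r => Fin.cases ?_ (fun i => ?_) r) r
    · rw [hv0, h00, h01]
      field_simp
    · rw [Fin.succ_zero_eq_one, hv1, h10, h11]
      simp only [eigenForm, map_sub, map_add, map_mul, eval_X] at hp
      field_simp
      linear_combination -hp
    · rw [hvz, hu, hv]
      ring
  refine ⟨Submodule.span K {v}, ?_, finrank_span_singleton fun h => hy ?_, ?_⟩
  · rw [Submodule.span_singleton_le_iff_mem]
    intro i
    refine Fin.cases (fun h => ?_) (fun i => Fin.cases (fun h => ?_) (fun i _ => hvz i) i) i
    · simp at h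
    · simp at h
  · rw [← hv0, h, Pi.zero_apply]
  · intro w hw
    obtain ⟨c, rfl⟩ := Submodule.mem_span_singleton.1 hw
    rw [Matrix.mulVec_smul, hMv]
    exact Submodule.smul_mem _ _ (Submodule.smul_mem _ _ (Submodule.mem_span_singleton_self v))

theorem eval_toricHom_eq_zero {f : MatCoordRing K (m + 2)} (hf : f ∈ kalmanIdeal K (m + 2) 2 1)
    (p : ToricVar m → K) (hy : p (colVar m 1) ≠ 0) (hp : eval p (eigenForm K m) = 0) :
    eval p (toricHom K f) = 0 := by
  have h := hf _ (toricPoint_mem_kalmanSet p hy hp)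
  rw [← h, toricHom, ← aeval_eq_eval, ← AlgHom.comp_apply, comp_aeval, aeval_eq_eval]

theorem not_colVar_dvd_eigenForm : ¬ X (colVar m 1) ∣ eigenForm K m := by
  rintro ⟨R, hR⟩
  have := congrArg (eval fun z => if z = alphaVar m 0 1 ∨ z = colVar m 0 then (1 : K) else 0) hR
  simp [eigenForm] at this

theorem eigenForm_dvd_toricHom [Infinite K] {f : MatCoordRing K (m + 2)}
    (hf : f ∈ kalmanIdeal K (m + 2) 2 1) : eigenForm K m ∣ toricHom K f := by
  obtain ⟨N, G, H, h, hG⟩ := exists_pow_mul_eq_add_eigenForm_mul (toricHom K f)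
  have hyG : X (colVar m 1) * G = 0 := by
    refine MvPolynomial.funext fun p => ?_
    rw [map_mul, eval_X, map_zero]
    by_cases hy : p (colVar m 1) = 0
    · rw [hy, zero_mul]
    set c := (p (alphaVar m 0 1) * p (colVar m 0) * p (colVar m 0)
      + p (alphaVar m 1 1) * p (colVar m 0) * p (colVar m 1)
      - p (alphaVar m 0 0) * p (colVar m 1) * p (colVar m 0)) / p (colVar m 1) ^ 2 with hc
    set q := Function.update p (alphaVar m 1 0) c with hq
    have hqne {z : ToricVar m} (hz : z ≠ alphaVar m 1 0) : q z = p z :=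
      Function.update_of_ne hz _ _
    have hqy : q (colVar m 1) = p (colVar m 1) := hqne (by simp)
    have hqQ : eval q (eigenForm K m) = 0 := by
      simp only [eigenForm, map_sub, map_add, map_mul, eval_X]
      rw [hqy, hqne (z := colVar m 0) (by simp), hqne (z := alphaVar m 0 0) (by simp),
        hqne (z := alphaVar m 0 1) (by simp),
        hqne (z := alphaVar m 1 1) (by simp), hq, Function.update_self, hc]
      field_simp
      ring
    have hqG : eval q G = 0 := by
      have := congrArg (eval q) h
      rwa [map_mul, eval_toricHom_eq_zero hf q (by rwa [hqy]) hqQ, map_add, map_mul, hqQ,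
        mul_zero, zero_mul, add_zero, eq_comm] at this
    have hpG : eval p G = eval q G := by
      rw [← hG, eraseLowerLeft, ← aeval_eq_eval, ← aeval_eq_eval, ← AlgHom.comp_apply,
        ← AlgHom.comp_apply, comp_aeval, comp_aeval]
      congr 2
      ext z
      split_ifs with hz
      · simp
      · simp [hqne hz]
    rw [hpG, hqG, mul_zero]
  have hG0 : G = 0 := (mul_eq_zero.1 hyG).resolve_left (X_ne_zero _)
  rw [hG0, zero_add] at h
  obtain ⟨g, rfl⟩ := (X_prime (R := K)).pow_dvd_of_dvd_mul_left N not_colVar_dvd_eigenForm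
    (Dvd.intro _ h)
  refine ⟨g, mul_left_cancel₀ (pow_ne_zero N (X_ne_zero (R := K) (colVar m 1))) ?_⟩
  rw [h]
  ring

theorem kalmanIdeal_eq_span_kalmanGen [Infinite K] :
    kalmanIdeal K (m + 2) 2 1 = Ideal.span (Set.range (kalmanGen K (m := m))) := by
  refine le_antisymm (fun f hf => ?_) span_kalmanGen_le_kalmanIdeal
  obtain ⟨g, hg⟩ := eigenForm_dvd_toricHom hf
  rw [← Ideal.Quotient.eq_zero_iff_mem, ← toricSection_toricHom, hg, toricSection_eigenForm_mul]

end Saturation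

theorem card_pairs_le (m : ℕ) :
    Fintype.card {p : Fin m × Fin m // p.1 ≤ p.2} = (m + 1).choose 2 := by
  rw [← Fintype.card_congr Sym2.sortEquiv, Sym2.card, Fintype.card_fin]

theorem card_pairs_lt (m : ℕ) :
    Fintype.card {p : Fin m × Fin m // p.1 < p.2} = m.choose 2 := by
  have hle := card_pairs_le m
  have hdiag : Fintype.card {p : Fin m × Fin m // p.1 = p.2} = m := by
    rw [Fintype.card_congr (Equiv.ofBijective
      (fun p : {p : Fin m × Fin m // p.1 = p.2} => p.1.1) ⟨?_, fun i => ⟨⟨(i, i), rfl⟩, rfl⟩⟩),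
      Fintype.card_fin]
    rintro ⟨⟨i, j⟩, hij⟩ ⟨⟨k, l⟩, hkl⟩ h
    dsimp only at hij hkl h
    subst hij hkl h
    rfl
  have hor : Fintype.card {p : Fin m × Fin m // p.1 ≤ p.2} =
      Fintype.card {p : Fin m × Fin m // p.1 < p.2 ∨ p.1 = p.2} :=
    Fintype.card_congr (Equiv.subtypeEquivRight fun p => le_iff_lt_or_eq)
  rw [hor, Fintype.card_subtype_or_disjoint, hdiag, Nat.choose_succ_succ' m 1,
    Nat.choose_one_right] at hle
  · simp only [Nat.reduceAdd] at hle
    omega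
  · rw [Pi.disjoint_iff]
    intro p
    rw [Prop.disjoint_iff]
    exact not_and.2 fun h => h.ne


theorem stmt9 (K : Type*) [Field K] [IsAlgClosed K] (n : ℕ) (hn : 3 ≤ n) :
    (Module.finrank K (gradedPiece K n (kalmanIdeal K n 2 1) 2) -
      Module.finrank K (gradedPiece K n (irrelevantIdeal K n * kalmanIdeal K n 2 1) 2)
        = (n - 2).choose 2) ∧
    (Module.finrank K (gradedPiece K n (kalmanIdeal K n 2 1) 3) -
      Module.finrank K (gradedPiece K n (irrelevantIdeal K n * kalmanIdeal K n 2 1) 3)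
        = (n - 1).choose 2) ∧
    (∀ j : ℕ, j ≠ 2 → j ≠ 3 →
      Module.finrank K (gradedPiece K n (kalmanIdeal K n 2 1) j) -
        Module.finrank K (gradedPiece K n (irrelevantIdeal K n * kalmanIdeal K n 2 1) j)
          = 0) := by
  obtain ⟨m, rfl⟩ : ∃ m, n = m + 2 := ⟨n - 2, by omega⟩
  have : Infinite K := IsAlgClosed.instInfinite
  have key := finrank_gradedPiece_span_sub (kalmanGen_isHomogeneous K (m := m))
    (coeff_kalmanGenLead K) (coeff_kalmanGen_of_lt_kalmanGenLead K)
  rw [← kalmanIdeal_eq_span_kalmanGen] at key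
  simp only [key]
  refine ⟨?_, ?_, fun j h2 h3 => ?_⟩
  · rw [Nat.add_sub_cancel, ← card_pairs_lt]
    refine (Fintype.card_congr (Equiv.ofBijective (fun p => ⟨Sum.inl p, rfl⟩) ⟨?_, ?_⟩)).symm
    · intro p q h
      exact Sum.inl_injective (congrArg Subtype.val h)
    · rintro ⟨p | p, hp⟩
      · exact ⟨p, rfl⟩
      · simp [kalmanGenDeg] at hp
  · rw [show m + 2 - 1 = m + 1 by omega, ← card_pairs_le]
    refine (Fintype.card_congr (Equiv.ofBijective (fun p => ⟨Sum.inr p, rfl⟩) ⟨?_, ?_⟩)).symm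
    · intro p q h
      exact Sum.inr_injective (congrArg Subtype.val h)
    · rintro ⟨p | p, hp⟩
      · simp [kalmanGenDeg] at hp
      · exact ⟨p, rfl⟩
  · rw [Fintype.card_eq_zero_iff]
    refine ⟨?_⟩
    rintro ⟨p | p, hp⟩
    · exact h2 hp.symm
    · exact h3 hp.symm
end
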